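/- arXiv:1411.4097 — 2 statements merged into one kernel-verified Lean document; each statement's English description precedes it below -/
import Mathlib

section
/- For the DRB game on the k-dimensional grid, there exist constants c1, c2 > 0 and n0 ∈ ℕ (all depending only on k and the granularity γ) such that for all n ≥ n0: the price of stability satisfies c1 · ln n ≤ PoS ≤ c2 · ln n, where PoS = (max over all profiles r of SW(r)) / (max over Nash equilibria r* of SW(r*)). -/
open Finset

noncomputable section

namespace DRB

/-- Nodes of the `k`-dimensional grid (torus) with side length `n`. -/
abbrev Node (n k : ℕ) := Fin k → Fin n

/-- Grid (Manhattan) distance on the torus: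
`d_M(u,v) = Σ_i min(|u_i - v_i|, n - |u_i - v_i|)`. -/
def dM (n k : ℕ) (u v : Node n k) : ℕ :=
  ∑ i, min ((u i : ℤ) - (v i : ℤ)).natAbs (n - ((u i : ℤ) - (v i : ℤ)).natAbs)

/-- All nodes different from `u`. -/
def others (n k : ℕ) (u : Node n k) : Finset (Node n k) :=
  Finset.univ.filter (fun v => v ≠ u)

/-- Normalization constant `c(s) = Σ_{v ≠ u} d_M(u,v)^{-s}` for node `u`. -/
def cnorm (n k : ℕ) (u : Node n k) (s : ℝ) : ℝ :=
  ∑ v ∈ others n k u, (dM n k u v : ℝ) ^ (-s)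

/-- Long-range link probability `p_u(v, s) = d_M(u,v)^{-s} / c(s)`. -/
def linkProb (n k : ℕ) (u v : Node n k) (s : ℝ) : ℝ :=
  (dM n k u v : ℝ) ^ (-s) / cnorm n k u s

/-- Link distance `D(s) = Σ_{v ≠ u} p_u(v,s) · d_M(u,v)` of node `u`. -/
def linkDist (n k : ℕ) (u : Node n k) (s : ℝ) : ℝ :=
  ∑ v ∈ others n k u, linkProb n k u v s * (dM n k u v : ℝ)

/-- Reciprocity `P_u(r) = Σ_{v ≠ u} p_u(v, r_u) · p_v(u, r_v)`. -/
def recip (n k : ℕ) (r : Node n k → ℝ) (u : Node n k) : ℝ :=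
  ∑ v ∈ others n k u, linkProb n k u v (r u) * linkProb n k v u (r v)

/-- DRB payoff `π_u(r) = D(r_u) · P_u(r)`. -/
def payoff (n k : ℕ) (r : Node n k → ℝ) (u : Node n k) : ℝ :=
  linkDist n k u (r u) * recip n k r u

/-- Membership in the strategy set `Σ = {0, γ, 2γ, 3γ, ...}`. -/
def InSigma (γ s : ℝ) : Prop := ∃ m : ℕ, s = m * γ

/-- A valid strategy profile (every coordinate lies in `Σ`). -/
def ValidProfile (n k : ℕ) (γ : ℝ) (r : Node n k → ℝ) : Prop :=
  ∀ u, InSigma γ (r u)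

/-- Nash equilibrium of the DRB game with strategy set `Σ` of granularity `γ`. -/
def IsNash (n k : ℕ) (γ : ℝ) (r : Node n k → ℝ) : Prop :=
  ∀ u : Node n k, ∀ s : ℝ, InSigma γ s →
    payoff n k r u ≥ payoff n k (Function.update r u s) u

/-- Strict Nash equilibrium. -/
def IsStrictNash (n k : ℕ) (γ : ℝ) (r : Node n k → ℝ) : Prop :=
  ∀ u : Node n k, ∀ s : ℝ, InSigma γ s → s ≠ r u →
    payoff n k r u > payoff n k (Function.update r u s) u

/-- `t`-strong Nash equilibrium: no coalition of size ≤ `t` has a weakly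
improving joint deviation that strictly improves some member. -/
def IsTStrongNash (n k : ℕ) (γ : ℝ) (t : ℕ) (r : Node n k → ℝ) : Prop :=
  ¬ ∃ (C : Finset (Node n k)) (s : Node n k → ℝ),
      C.Nonempty ∧ C.card ≤ t ∧ (∀ u ∈ C, InSigma γ (s u)) ∧
      (∀ u ∈ C,
        payoff n k (fun v => if v ∈ C then s v else r v) u ≥ payoff n k r u) ∧
      (∃ u ∈ C,
        payoff n k (fun v => if v ∈ C then s v else r v) u > payoff n k r u)

/-- Strong Nash equilibrium: coalitions of any size. -/
def IsStrongNash (n k : ℕ) (γ : ℝ) (r : Node n k → ℝ) : Prop :=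
  ¬ ∃ (C : Finset (Node n k)) (s : Node n k → ℝ),
      C.Nonempty ∧ (∀ u ∈ C, InSigma γ (s u)) ∧
      (∀ u ∈ C,
        payoff n k (fun v => if v ∈ C then s v else r v) u ≥ payoff n k r u) ∧
      (∃ u ∈ C,
        payoff n k (fun v => if v ∈ C then s v else r v) u > payoff n k r u)

/-- `b_u(j)`: the number of nodes at grid distance exactly `j` from `u`. -/
def countAt (n k : ℕ) (u : Node n k) (j : ℕ) : ℕ :=
  (Finset.univ.filter (fun v => v ≠ u ∧ dM n k u v = j)).card

/-- One asynchronous best-response step: a single node switches to a best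
response to the current profile, all other strategies unchanged. -/
def BRStep (n k : ℕ) (γ : ℝ) (r r' : Node n k → ℝ) : Prop :=
  ∃ (u : Node n k) (s : ℝ), InSigma γ s ∧
    (∀ t : ℝ, InSigma γ t →
      payoff n k (Function.update r u s) u ≥ payoff n k (Function.update r u t) u) ∧
    r' = Function.update r u s

/-- One synchronous best-response step: every node simultaneously switches
to a best response to the current profile `r`. -/
def SyncStep (n k : ℕ) (γ : ℝ) (r r' : Node n k → ℝ) : Prop :=
  ∀ u : Node n k, InSigma γ (r' u) ∧
    ∀ t : ℝ, InSigma γ t →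
      payoff n k (Function.update r u (r' u)) u ≥
        payoff n k (Function.update r u t) u

end DRB


namespace DRB

/-- One-dimensional torus distance. -/
def del (n : ℕ) (a b : Fin n) : ℕ :=
  min ((a : ℤ) - (b : ℤ)).natAbs (n - ((a : ℤ) - (b : ℤ)).natAbs)

lemma dM_eq (n k : ℕ) (u v : Node n k) : dM n k u v = ∑ i, del n (u i) (v i) := rfl

lemma del_comm (n : ℕ) (a b : Fin n) : del n a b = del n b a := by
  unfold del
  rw [← Int.natAbs_neg, neg_sub]

lemma dM_comm (n k : ℕ) (u v : Node n k) : dM n k u v = dM n k v u := by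
  simp only [dM_eq]
  exact Finset.sum_congr rfl (fun i _ => del_comm n _ _)

lemma del_eq_zero {n : ℕ} {a b : Fin n} (h : del n a b = 0) : a = b := by
  unfold del at h
  have := a.2
  have := b.2
  ext
  omega

lemma del_le (n : ℕ) (a b : Fin n) : del n a b ≤ n / 2 := by
  unfold del
  omega

lemma dM_pos {n k : ℕ} {u v : Node n k} (h : v ≠ u) : 1 ≤ dM n k u v := by
  by_contra hc
  have h0 : dM n k u v = 0 := by omega
  rw [dM_eq, Finset.sum_eq_zero_iff] at h0
  exact h (funext fun i => (del_eq_zero (h0 i (Finset.mem_univ i))).symm)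

lemma del_le_dM {n k : ℕ} (u v : Node n k) (i : Fin k) : del n (u i) (v i) ≤ dM n k u v := by
  rw [dM_eq]
  exact Finset.single_le_sum (f := fun i => del n (u i) (v i)) (fun _ _ => Nat.zero_le _)
    (Finset.mem_univ i)

lemma dM_le_mul {n k : ℕ} (u v : Node n k) (j : ℕ) (h : ∀ i, del n (u i) (v i) ≤ j) :
    dM n k u v ≤ k * j := by
  rw [dM_eq]
  calc _ ≤ ∑ _i : Fin k, j := Finset.sum_le_sum (fun i _ => h i)
    _ = k * j := by simp

lemma dM_le {n k : ℕ} (u v : Node n k) : dM n k u v ≤ k * n :=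
  dM_le_mul u v n (fun i => (del_le n _ _).trans (Nat.div_le_self _ _))

/-- sphere in one coordinate -/
def Sph (n : ℕ) (a : Fin n) (j : ℕ) : Finset (Fin n) := Finset.univ.filter (fun b => del n a b = j)
/-- ball in one coordinate -/
def Bal (n : ℕ) (a : Fin n) (j : ℕ) : Finset (Fin n) := Finset.univ.filter (fun b => del n a b ≤ j)

lemma mem_Sph {n : ℕ} {a b : Fin n} {j : ℕ} : b ∈ Sph n a j ↔ del n a b = j := by simp [Sph]

lemma Sph_card_le (n : ℕ) (a : Fin n) (j : ℕ) : (Sph n a j).card ≤ 4 := by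
  have h : ((Sph n a j).image (fun b : Fin n => (b : ℤ))) ⊆
      ({(a : ℤ) + j, (a : ℤ) - j, (a : ℤ) + n - j, (a : ℤ) - n + j} : Finset ℤ) := by
    intro x hx
    rw [Finset.mem_image] at hx
    obtain ⟨b, hb, rfl⟩ := hx
    rw [mem_Sph] at hb
    unfold del at hb
    have := a.2
    have := b.2
    simp only [Finset.mem_insert, Finset.mem_singleton]
    omega
  have h2 := Finset.card_le_card h
  rw [Finset.card_image_of_injective] at h2
  · exact h2.trans Finset.card_le_four
  · intro x y hxy
    ext
    simpa using hxy

lemma Bal_eq (n : ℕ) (a : Fin n) (j : ℕ) :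
    Bal n a j = (Finset.range (j+1)).biUnion (fun i => Sph n a i) := by
  ext b
  simp [Bal, Sph]

lemma Bal_card_le (n : ℕ) (a : Fin n) (j : ℕ) : (Bal n a j).card ≤ 4 * (j+1) := by
  rw [Bal_eq]
  refine (Finset.card_biUnion_le_card_mul _ _ 4 (fun i _ => Sph_card_le n a i)).trans ?_
  simp [mul_comm]

lemma Sph_card_ge (n : ℕ) (a : Fin n) (j : ℕ) (hj : j ≤ n / 2) : 1 ≤ (Sph n a j).card := by
  rw [Nat.one_le_iff_ne_zero, Finset.card_ne_zero]
  have ha := a.2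
  by_cases h : (a : ℕ) + j < n
  · refine ⟨⟨a + j, h⟩, ?_⟩
    rw [mem_Sph]
    simp only [del]
    push_cast
    omega
  · refine ⟨⟨a + j - n, by omega⟩, ?_⟩
    rw [mem_Sph]
    simp only [del]
    omega

lemma Bal_card_ge (n : ℕ) (a : Fin n) (j : ℕ) (hj : j ≤ n / 2) : j ≤ (Bal n a j).card := by
  rw [Bal_eq, Finset.card_biUnion]
  · calc j ≤ ∑ _i ∈ Finset.range (j+1), 1 := by simp
      _ ≤ _ := Finset.sum_le_sum (fun i hi => Sph_card_ge n a i (by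
        have := Finset.mem_range.1 hi; omega))
  · intro x _ y _ hxy
    rw [Function.onFun, Finset.disjoint_left]
    intro b hb hb'
    rw [mem_Sph] at hb hb'
    exact hxy (hb.symm.trans hb')

/-- coordinate `i` at distance exactly `j`, all others at most `j`. -/
def Tset (n k : ℕ) (u : Node n k) (i : Fin k) (j : ℕ) : Finset (Node n k) :=
  Fintype.piFinset (fun i' => if i' = i then Sph n (u i') j else Bal n (u i') j)

lemma Tset_card (n k : ℕ) (u : Node n k) (i : Fin k) (j : ℕ) :
    (Tset n k u i j).card = (Sph n (u i) j).card *
      ∏ i' ∈ Finset.univ.erase i, (Bal n (u i') j).card := by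
  rw [Tset, Fintype.card_piFinset, ← Finset.mul_prod_erase _ _ (Finset.mem_univ i)]
  congr 1
  · simp
  · refine Finset.prod_congr rfl (fun i' hi' => ?_)
    rw [if_neg (Finset.ne_of_mem_erase hi')]

lemma Tset_card_le (n k : ℕ) (u : Node n k) (i : Fin k) (j : ℕ) :
    (Tset n k u i j).card ≤ 4 * (4 * (j+1))^(k-1) := by
  rw [Tset_card]
  refine Nat.mul_le_mul (Sph_card_le _ _ _) ?_
  refine (Finset.prod_le_pow_card _ _ _ (fun i' _ => Bal_card_le n (u i') j)).trans ?_
  simp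

lemma Tset_card_ge (n k : ℕ) (u : Node n k) (i : Fin k) (j : ℕ) (hj : j ≤ n / 2) :
    j^(k-1) ≤ (Tset n k u i j).card := by
  rw [Tset_card]
  calc j^(k-1) = 1 * ∏ _i ∈ Finset.univ.erase i, j := by simp
    _ ≤ _ := Nat.mul_le_mul (Sph_card_ge _ _ _ hj)
      (Finset.prod_le_prod (fun _ _ => Nat.zero_le _) (fun i' _ => Bal_card_ge n (u i') j hj))

lemma mem_Tset {n k : ℕ} {u v : Node n k} {i : Fin k} {j : ℕ} :
    v ∈ Tset n k u i j ↔ del n (u i) (v i) = j ∧ ∀ i', del n (u i') (v i') ≤ j := by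
  simp only [Tset, Fintype.mem_piFinset]
  constructor
  · intro h
    have h1 := h i
    simp only [if_true, Sph, Finset.mem_filter, Finset.mem_univ, true_and] at h1
    refine ⟨h1, fun i' => ?_⟩
    by_cases hi : i' = i
    · subst hi; exact h1.le
    · have := h i'
      simpa [hi, Bal] using this
  · rintro ⟨h1, h2⟩ i'
    by_cases hi : i' = i
    · subst hi; simpa [Sph] using h1
    · simpa [hi, Bal] using h2 i'

lemma mem_others {n k : ℕ} {u v : Node n k} : v ∈ others n k u ↔ v ≠ u := by
  simp [others]

lemma cnorm_le (n k : ℕ) (hk : 1 ≤ k) (u : Node n k) (s : ℝ) (hs : 0 ≤ s) :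
    cnorm n k u s ≤ (k * 4 * 8^(k-1) : ℝ) * ∑ j ∈ Finset.Icc 1 n, (j:ℝ)^((k:ℝ) - 1 - s) := by
  classical
  have key : ∀ v ∈ others n k u, (dM n k u v : ℝ) ^ (-s) ≤
      ∑ i : Fin k, ∑ j ∈ Finset.Icc 1 n, if v ∈ Tset n k u i j then (j:ℝ)^(-s) else 0 := by
    intro v hv
    rw [mem_others] at hv
    have : Nonempty (Fin k) := ⟨⟨0, hk⟩⟩
    obtain ⟨i, hi⟩ := Finite.exists_max (fun i => del n (u i) (v i))
    have hpos : 1 ≤ del n (u i) (v i) := by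
      by_contra hc
      apply hv
      funext i'
      have := hi i'
      exact (del_eq_zero (by omega)).symm
    have hj : del n (u i) (v i) ∈ Finset.Icc 1 n :=
      Finset.mem_Icc.2 ⟨hpos, (del_le n _ _).trans (Nat.div_le_self _ _)⟩
    have hmem : v ∈ Tset n k u i (del n (u i) (v i)) := mem_Tset.2 ⟨rfl, hi⟩
    have hnn : ∀ i : Fin k, ∀ j ∈ Finset.Icc 1 n,
        0 ≤ (if v ∈ Tset n k u i j then (j:ℝ)^(-s) else 0) := by
      intro i j _
      split_ifs <;> positivity
    calc (dM n k u v : ℝ) ^ (-s) ≤ (del n (u i) (v i) : ℝ)^(-s) := by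
          apply Real.rpow_le_rpow_of_nonpos
          · exact_mod_cast hpos
          · exact_mod_cast del_le_dM u v i
          · linarith
      _ = (if v ∈ Tset n k u i (del n (u i) (v i)) then (del n (u i) (v i):ℝ)^(-s) else 0) := by
          rw [if_pos hmem]
      _ ≤ ∑ j ∈ Finset.Icc 1 n, (if v ∈ Tset n k u i j then (j:ℝ)^(-s) else 0) :=
          Finset.single_le_sum (f := fun j : ℕ => if v ∈ Tset n k u i j then (j:ℝ)^(-s) else 0)
            (hnn i) hj
      _ ≤ _ := Finset.single_le_sum
            (f := fun i => ∑ j ∈ Finset.Icc 1 n, (if v ∈ Tset n k u i j then (j:ℝ)^(-s) else 0))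
            (fun i _ => Finset.sum_nonneg (hnn i)) (Finset.mem_univ i)
  calc cnorm n k u s ≤ ∑ v ∈ others n k u, ∑ i : Fin k, ∑ j ∈ Finset.Icc 1 n,
        (if v ∈ Tset n k u i j then (j:ℝ)^(-s) else 0) := Finset.sum_le_sum key
    _ ≤ ∑ v, ∑ i : Fin k, ∑ j ∈ Finset.Icc 1 n,
        (if v ∈ Tset n k u i j then (j:ℝ)^(-s) else 0) := by
        apply Finset.sum_le_sum_of_subset_of_nonneg (Finset.subset_univ _)
        intro v _ _
        refine Finset.sum_nonneg (fun i _ => Finset.sum_nonneg (fun j _ => ?_))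
        split_ifs <;> positivity
    _ = ∑ i : Fin k, ∑ j ∈ Finset.Icc 1 n, ((Tset n k u i j).card : ℝ) * (j:ℝ)^(-s) := by
        rw [Finset.sum_comm]
        refine Finset.sum_congr rfl (fun i _ => ?_)
        rw [Finset.sum_comm]
        refine Finset.sum_congr rfl (fun j _ => ?_)
        rw [← Finset.sum_filter]
        simp
    _ ≤ ∑ i : Fin k, ∑ j ∈ Finset.Icc 1 n, (4 * 8^(k-1) : ℝ) * (j:ℝ)^((k:ℝ)-1-s) := by
        refine Finset.sum_le_sum (fun i _ => Finset.sum_le_sum (fun j hj => ?_))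
        have hj1 := (Finset.mem_Icc.1 hj).1
        have hj0 : (0:ℝ) < j := by exact_mod_cast hj1
        have h1 : ((Tset n k u i j).card : ℝ) ≤ 4 * 8^(k-1) * (j:ℝ)^(k-1) := by
          have h2 : (Tset n k u i j).card ≤ 4 * (8 * j)^(k-1) := by
            refine (Tset_card_le n k u i j).trans ?_
            gcongr 4 * ?_ ^ _
            omega
          rw [mul_pow, ← mul_assoc] at h2
          exact_mod_cast h2
        have h3 : (j:ℝ)^((k:ℝ)-1-s) = (j:ℝ)^(k-1) * (j:ℝ)^(-s) := by
          rw [sub_eq_add_neg ((k:ℝ)-1) s, Real.rpow_add hj0, ← Real.rpow_natCast, Nat.cast_sub hk, Nat.cast_one]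
        rw [h3, ← mul_assoc]
        exact mul_le_mul_of_nonneg_right h1 (by positivity)
    _ = _ := by
        simp only [← Finset.mul_sum, Finset.sum_const, Finset.card_univ, Fintype.card_fin, nsmul_eq_mul]
        ring

lemma cnorm_ge (n k : ℕ) (hk : 1 ≤ k) (u : Node n k) (s : ℝ) (hs : 0 ≤ s) :
    (k:ℝ)^(-s) * ∑ j ∈ Finset.Icc 1 (n/2), (j:ℝ)^((k:ℝ) - 1 - s) ≤ cnorm n k u s := by
  classical
  let i0 : Fin k := ⟨0, hk⟩
  have hk0 : (0:ℝ) < k := by exact_mod_cast hk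
  have hdisj : Set.PairwiseDisjoint (↑(Finset.Icc 1 (n/2))) (fun j => Tset n k u i0 j) := by
    intro x _ y _ hxy
    rw [Function.onFun, Finset.disjoint_left]
    intro v hv hv'
    exact hxy ((mem_Tset.1 hv).1.symm.trans (mem_Tset.1 hv').1)
  calc (k:ℝ)^(-s) * ∑ j ∈ Finset.Icc 1 (n/2), (j:ℝ)^((k:ℝ) - 1 - s)
      = ∑ j ∈ Finset.Icc 1 (n/2), (k:ℝ)^(-s) * (j:ℝ)^((k:ℝ) - 1 - s) := by rw [Finset.mul_sum]
    _ ≤ ∑ j ∈ Finset.Icc 1 (n/2), ∑ v ∈ Tset n k u i0 j, (dM n k u v : ℝ) ^ (-s) := by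
        refine Finset.sum_le_sum (fun j hj => ?_)
        obtain ⟨hj1, hj2⟩ := Finset.mem_Icc.1 hj
        have hj0 : (0:ℝ) < j := by exact_mod_cast hj1
        have h3 : (j:ℝ)^((k:ℝ)-1-s) = (j:ℝ)^(k-1) * (j:ℝ)^(-s) := by
          rw [sub_eq_add_neg ((k:ℝ)-1) s, Real.rpow_add hj0, ← Real.rpow_natCast, Nat.cast_sub hk, Nat.cast_one]
        calc (k:ℝ)^(-s) * (j:ℝ)^((k:ℝ) - 1 - s) = (j:ℝ)^(k-1) * ((k:ℝ) * j)^(-s) := by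
              rw [h3, Real.mul_rpow hk0.le hj0.le]; ring
          _ ≤ (Tset n k u i0 j).card * ((k:ℝ) * j)^(-s) := by
              apply mul_le_mul_of_nonneg_right _ (by positivity)
              exact_mod_cast Tset_card_ge n k u i0 j hj2
          _ = ∑ v ∈ Tset n k u i0 j, ((k:ℝ) * j)^(-s) := by simp
          _ ≤ _ := by
              refine Finset.sum_le_sum (fun v hv => ?_)
              obtain ⟨h1, h2⟩ := mem_Tset.1 hv
              have := del_le_dM u v i0
              apply Real.rpow_le_rpow_of_nonpos
              · have : 1 ≤ dM n k u v := by omega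
                exact_mod_cast this
              · exact_mod_cast dM_le_mul u v j h2
              · linarith
    _ = ∑ v ∈ (Finset.Icc 1 (n/2)).biUnion (fun j => Tset n k u i0 j), (dM n k u v : ℝ) ^ (-s) := by
        rw [Finset.sum_biUnion hdisj]
    _ ≤ _ := by
        apply Finset.sum_le_sum_of_subset_of_nonneg
        · intro v hv
          rw [Finset.mem_biUnion] at hv
          obtain ⟨j, hj, hv⟩ := hv
          rw [mem_others]
          rintro rfl
          have h1 := (mem_Tset.1 hv).1
          have := (Finset.mem_Icc.1 hj).1
          simp [del] at h1
          omega
        · intro v _ _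
          positivity

lemma cnorm_ge_triv (n k : ℕ) (hn : 2 ≤ n) (hk : 1 ≤ k) (u : Node n k) (s : ℝ) (hs : 0 ≤ s) :
    (2:ℝ)⁻¹ * (k:ℝ)^(-s) * (n:ℝ)^((k:ℝ)-s) ≤ cnorm n k u s := by
  have hk0 : (0:ℝ) < k := by exact_mod_cast hk
  have hn0 : (0:ℝ) < n := by exact_mod_cast (by omega : 0 < n)
  have hcard : (others n k u).card = n^k - 1 := by
    have : others n k u = Finset.univ.erase u := by ext v; simp [others]
    rw [this, Finset.card_erase_of_mem (Finset.mem_univ _)]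
    simp
  have hnk : 2 ≤ n^k := by
    calc 2 ≤ n^1 := by simpa using hn
      _ ≤ n^k := Nat.pow_le_pow_right (by omega) hk
  calc (2:ℝ)⁻¹ * (k:ℝ)^(-s) * (n:ℝ)^((k:ℝ)-s)
      = ((n:ℝ)^k/2) * ((k:ℝ)*n)^(-s) := by
        rw [Real.mul_rpow hk0.le hn0.le, sub_eq_add_neg, Real.rpow_add hn0, Real.rpow_natCast]; ring
    _ ≤ ((others n k u).card : ℝ) * ((k:ℝ)*n)^(-s) := by
        apply mul_le_mul_of_nonneg_right _ (by positivity)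
        rw [hcard, Nat.cast_sub (by omega)]
        have : (2:ℝ) ≤ (n:ℝ)^k := by exact_mod_cast hnk
        push_cast
        linarith
    _ = ∑ v ∈ others n k u, ((k:ℝ)*n)^(-s) := by simp
    _ ≤ _ := by
        refine Finset.sum_le_sum (fun v hv => ?_)
        rw [mem_others] at hv
        apply Real.rpow_le_rpow_of_nonpos
        · exact_mod_cast dM_pos hv
        · exact_mod_cast dM_le u v
        · linarith

/-- A distance one neighbour whose first coordinate has opposite parity. -/
lemma exists_nbr (n k : ℕ) (hn : 2 ≤ n) (hk : 1 ≤ k) (u : Node n k) :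
    ∃ v : Node n k, v ≠ u ∧ dM n k u v = 1 ∧
      (((v ⟨0, hk⟩ : Fin n) : ℕ) % 2 ≠ ((u ⟨0, hk⟩ : Fin n) : ℕ) % 2) := by
  classical
  have main : ∀ b : Fin n, del n (u ⟨0, hk⟩) b = 1 → (b : ℕ) % 2 ≠ ((u ⟨0, hk⟩ : Fin n) : ℕ) % 2 →
      ∃ v : Node n k, v ≠ u ∧ dM n k u v = 1 ∧
      (((v ⟨0, hk⟩ : Fin n) : ℕ) % 2 ≠ ((u ⟨0, hk⟩ : Fin n) : ℕ) % 2) := by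
    intro b hb hb2
    refine ⟨Function.update u ⟨0, hk⟩ b, ?_, ?_, ?_⟩
    · intro h
      have := congrFun h ⟨0, hk⟩
      simp only [Function.update_self] at this
      rw [this] at hb2
      exact hb2 rfl
    · rw [dM_eq, Finset.sum_eq_single ⟨0, hk⟩]
      · simpa using hb
      · intro i _ hi
        rw [Function.update_of_ne hi]
        simp [del]
      · simp
    · simpa using hb2
  have ha := (u ⟨0, hk⟩).2
  by_cases h : ((u ⟨0, hk⟩ : Fin n) : ℕ) + 1 < n
  · refine main ⟨_, h⟩ ?_ ?_
    · simp only [del]; push_cast; omega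
    · simp only; omega
  · refine main ⟨((u ⟨0, hk⟩ : Fin n) : ℕ) - 1, by omega⟩ ?_ ?_
    · simp only [del]; omega
    · simp only; omega

lemma cnorm_ge_one (n k : ℕ) (hn : 2 ≤ n) (hk : 1 ≤ k) (u : Node n k) (s : ℝ) :
    1 ≤ cnorm n k u s := by
  obtain ⟨v, hv, hd, _⟩ := exists_nbr n k hn hk u
  have : (dM n k u v : ℝ)^(-s) ≤ cnorm n k u s :=
    Finset.single_le_sum (f := fun v => (dM n k u v : ℝ)^(-s)) (fun _ _ => by positivity)
      (mem_others.2 hv)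
  simpa [hd] using this

lemma cnorm_anti (n k : ℕ) (u : Node n k) (s t : ℝ) (h : s ≤ t) :
    cnorm n k u t ≤ cnorm n k u s := by
  refine Finset.sum_le_sum (fun v hv => ?_)
  have := dM_pos (mem_others.1 hv)
  apply Real.rpow_le_rpow_of_exponent_le
  · exact_mod_cast this
  · linarith

lemma linkDist_eq (n k : ℕ) (u : Node n k) (s : ℝ) :
    linkDist n k u s = cnorm n k u (s-1) / cnorm n k u s := by
  unfold linkDist linkProb
  rw [cnorm.eq_1 n k u (s-1), Finset.sum_div]
  refine Finset.sum_congr rfl (fun v hv => ?_)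
  have := dM_pos (mem_others.1 hv)
  have h0 : (0:ℝ) < dM n k u v := by exact_mod_cast this
  rw [neg_sub, sub_eq_add_neg, add_comm, Real.rpow_add h0, Real.rpow_one]
  ring

end DRB
namespace DRB

lemma sum_inv_le (n : ℕ) : ∑ j ∈ Finset.Icc 1 n, (j:ℝ)⁻¹ ≤ 1 + Real.log n := by
  have := harmonic_le_one_add_log n
  rw [harmonic_eq_sum_Icc] at this
  push_cast at this
  exact this

lemma le_sum_inv (n : ℕ) : Real.log ((n:ℝ) + 1) ≤ ∑ j ∈ Finset.Icc 1 n, (j:ℝ)⁻¹ := by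
  have := log_add_one_le_harmonic n
  rw [harmonic_eq_sum_Icc] at this
  push_cast at this
  exact this

lemma sum_rpow_neg_le (γ : ℝ) (h0 : 0 < γ) (h1 : γ ≤ 1/2) (n : ℕ) :
    ∑ j ∈ Finset.Icc 1 n, (j:ℝ)^(-γ) ≤ 2 * (n:ℝ)^(1-γ) := by
  induction n with
  | zero => simp; positivity
  | succ m ih =>
    rw [Finset.sum_Icc_succ_top (by omega)]
    have hm : (0:ℝ) < (m:ℝ) + 1 := by positivity
    have hb : (1 + (-1/((m:ℝ)+1)))^(1-γ) ≤ 1 + (1-γ) * (-1/((m:ℝ)+1)) := by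
      apply rpow_one_add_le_one_add_mul_self
      · rw [le_div_iff₀ hm]; linarith [(Nat.cast_nonneg m : (0:ℝ) ≤ m)]
      · linarith
      · linarith
    have he : (1 + (-1/((m:ℝ)+1))) = (m:ℝ)/((m:ℝ)+1) := by field_simp; ring
    rw [he, Real.div_rpow (Nat.cast_nonneg m) hm.le] at hb
    have hp : (0:ℝ) < ((m:ℝ)+1)^(1-γ) := by positivity
    rw [div_le_iff₀ hp] at hb
    have h3 : ((m:ℝ)+1)^(1-γ) = ((m:ℝ)+1) * ((m:ℝ)+1)^(-γ) := by
      rw [sub_eq_add_neg, Real.rpow_add hm, Real.rpow_one]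
    have hq : (0:ℝ) < ((m:ℝ)+1)^(-γ) := by positivity
    have h4 : (1 + (1-γ) * (-1/((m:ℝ)+1))) * ((m:ℝ)+1)^(1-γ) =
        ((m:ℝ)+1)^(1-γ) - (1-γ) * ((m:ℝ)+1)^(-γ) := by
      rw [h3]; field_simp; ring
    rw [h4] at hb
    push_cast
    nlinarith

lemma sum_rpow_neg_two_le : ∃ Z : ℝ, 0 < Z ∧ ∀ n : ℕ,
    ∑ j ∈ Finset.Icc 1 n, (j:ℝ)^(-(2:ℝ)) ≤ Z := by
  have hs : Summable (fun j : ℕ => (j:ℝ)^(-(2:ℝ))) := by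
    rw [Real.summable_nat_rpow]; norm_num
  refine ⟨1 + ∑' j : ℕ, (j:ℝ)^(-(2:ℝ)), ?_, fun n => ?_⟩
  · have : 0 ≤ ∑' j : ℕ, (j:ℝ)^(-(2:ℝ)) := tsum_nonneg (fun j => by positivity)
    linarith
  · have := hs.sum_le_tsum (Finset.Icc 1 n) (fun j _ => by positivity)
    linarith

structure Est (n k : ℕ) (γ A L x : ℝ) : Prop where
  hA : 1 ≤ A
  hL : 1 ≤ L
  hx : 0 < x
  hx1 : x ≤ 1
  ck_lo : ∀ u : Node n k, L ≤ A * cnorm n k u k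
  ck_hi : ∀ u : Node n k, cnorm n k u k ≤ A * L
  c2k : ∀ u : Node n k, cnorm n k u (2 * k) ≤ A
  Dk_lo : ∀ u : Node n k, (n:ℝ) ≤ A * L * linkDist n k u k
  Dk_hi : ∀ u : Node n k, L * linkDist n k u k ≤ A * n
  Dhi : ∀ u : Node n k, ∀ s : ℝ, (k:ℝ) + γ ≤ s → linkDist n k u s ≤ A * n * x^4
  Dtriv : ∀ u : Node n k, ∀ s : ℝ, linkDist n k u s ≤ A * n
  clo : ∀ u : Node n k, ∀ s : ℝ, s ≤ (k:ℝ) - γ → 1 ≤ A * x^4 * cnorm n k u s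

lemma exists_est (k : ℕ) (hk : 1 ≤ k) (γ : ℝ) (h0 : 0 < γ) (h1 : γ ≤ 1/2) :
    ∃ A : ℝ, 1 ≤ A ∧ ∀ n : ℕ, 4 ≤ n → Est n k γ A (Real.log n) ((n:ℝ)^(-γ/4)) := by
  obtain ⟨Z, hZ, hZs⟩ := sum_rpow_neg_two_le
  have hk1 : (1:ℝ) ≤ k := by exact_mod_cast hk
  have hk0 : (0:ℝ) < k := by linarith
  set K : ℝ := (k * 4 * 8^(k-1) : ℝ) with hK
  have hKp : 0 < K := by positivity
  set Ab : ℝ := 2 * (k:ℝ)^(k:ℝ) with hAb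
  have hAbp : 0 < Ab := by positivity
  set Ad : ℝ := 2 * (k:ℝ)^((k:ℝ)-1) with hAd
  have hAdp : 0 < Ad := by positivity
  set Ah : ℝ := 2 * (k:ℝ)^((k:ℝ)-γ) with hAh
  have hAhp : 0 < Ah := by positivity
  set A : ℝ := 1 + Ab + 2 * K + K * Z + Ad * (2*K) + Ab * K + k + Ah with hAdef
  have p1 : 0 < K * Z := by positivity
  have p2 : 0 < Ad * (2*K) := by positivity
  have p3 : 0 < Ab * K := by positivity
  refine ⟨A, by linarith, fun n hn => ?_⟩
  have hn4 : (4:ℝ) ≤ n := by exact_mod_cast hn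
  have hn0 : (0:ℝ) < n := by linarith
  have hL : 1 ≤ Real.log n := by
    rw [Real.le_log_iff_exp_le hn0]
    linarith [Real.exp_one_lt_d9]
  have hLp : 0 < Real.log n := by linarith
  have hx4 : ((n:ℝ)^(-γ/4))^4 = (n:ℝ)^(-γ) := by
    rw [← Real.rpow_natCast, ← Real.rpow_mul hn0.le]
    congr 1
    push_cast; ring
  have c1 : ∀ (u : Node n k) s, 1 ≤ cnorm n k u s := cnorm_ge_one n k (by omega) hk
  have cp : ∀ (u : Node n k) s, 0 < cnorm n k u s := fun u s => by linarith [c1 u s]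
  have lo : ∀ u : Node n k, Real.log n ≤ Ab * cnorm n k u k := by
    intro u
    have h := cnorm_ge n k hk u k hk0.le
    have he : ∀ j : ℕ, (j:ℝ)^((k:ℝ)-1-k) = (j:ℝ)⁻¹ := by
      intro j
      rw [← Real.rpow_neg_one]; congr 1; ring
    simp only [he] at h
    have h2 := le_sum_inv (n/2)
    have h3 : Real.log n ≤ 2 * Real.log (((n/2:ℕ):ℝ)+1) := by
      have : Real.log ((((n/2:ℕ):ℝ)+1)^2) = 2 * Real.log (((n/2:ℕ):ℝ)+1) := by
        rw [Real.log_pow]; norm_num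
      rw [← this]
      apply Real.log_le_log hn0
      have : n ≤ (n/2+1)^2 := by
        have : n ≤ 2*(n/2)+1 := by omega
        nlinarith
      exact_mod_cast this
    have h4 : (k:ℝ)^(k:ℝ) * (k:ℝ)^(-(k:ℝ)) = 1 := by
      rw [← Real.rpow_add hk0]; simp
    have h5 : (0:ℝ) < (k:ℝ)^(k:ℝ) := by positivity
    calc Real.log n ≤ 2 * ∑ j ∈ Finset.Icc 1 (n/2), (j:ℝ)⁻¹ := by linarith
      _ = Ab * ((k:ℝ)^(-(k:ℝ)) * ∑ j ∈ Finset.Icc 1 (n/2), (j:ℝ)⁻¹) := by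
        rw [hAb, show 2 * (k:ℝ)^(k:ℝ) * ((k:ℝ)^(-(k:ℝ)) * ∑ j ∈ Finset.Icc 1 (n/2), (j:ℝ)⁻¹)
          = 2 * ((k:ℝ)^(k:ℝ) * (k:ℝ)^(-(k:ℝ))) * ∑ j ∈ Finset.Icc 1 (n/2), (j:ℝ)⁻¹ by ring, h4]
        ring
      _ ≤ _ := by gcongr
  have hi : ∀ u : Node n k, cnorm n k u k ≤ 2 * K * Real.log n := by
    intro u
    have h := cnorm_le n k hk u k hk0.le
    have he : ∀ j : ℕ, (j:ℝ)^((k:ℝ)-1-k) = (j:ℝ)⁻¹ := by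
      intro j
      rw [← Real.rpow_neg_one]; congr 1; ring
    simp only [he] at h
    have h2 := sum_inv_le n
    nlinarith
  refine ⟨by linarith, hL, by positivity, ?_, ?_, ?_, ?_, ?_, ?_, ?_, ?_, ?_⟩
  · apply Real.rpow_le_one_of_one_le_of_nonpos <;> linarith
  · intro u
    refine (lo u).trans (mul_le_mul_of_nonneg_right (by linarith) (cp u _).le)
  · intro u
    exact (hi u).trans (mul_le_mul_of_nonneg_right (by linarith) hLp.le)
  · intro u
    have h := cnorm_le n k hk u (2*k) (by linarith)
    have h2 : ∑ j ∈ Finset.Icc 1 n, (j:ℝ)^((k:ℝ)-1-2*k) ≤ Z := by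
      refine le_trans (Finset.sum_le_sum (fun j hj => ?_)) (hZs n)
      apply Real.rpow_le_rpow_of_exponent_le
      · exact_mod_cast (Finset.mem_Icc.1 hj).1
      · linarith
    have : K * ∑ j ∈ Finset.Icc 1 n, (j:ℝ)^((k:ℝ)-1-2*k) ≤ K * Z := by gcongr
    linarith
  · intro u
    have h := cnorm_ge_triv n k (by omega) hk u ((k:ℝ)-1) (by linarith)
    have h4 : (k:ℝ)^((k:ℝ)-1) * (k:ℝ)^(-((k:ℝ)-1)) = 1 := by
      rw [← Real.rpow_add hk0]; simp
    have e : (n:ℝ)^((k:ℝ)-((k:ℝ)-1)) = n := by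
      rw [sub_sub_cancel, Real.rpow_one]
    rw [e] at h
    have hD : linkDist n k u k * cnorm n k u k = cnorm n k u ((k:ℝ)-1) := by
      rw [linkDist_eq, div_mul_cancel₀ _ (cp u _).ne']
    have hDp : 0 ≤ linkDist n k u k := by
      rw [linkDist_eq]; exact div_nonneg (cp u _).le (cp u _).le
    calc (n:ℝ) = Ad * ((2:ℝ)⁻¹ * (k:ℝ)^(-((k:ℝ)-1)) * n) := by
          rw [hAd, show 2 * (k:ℝ)^((k:ℝ)-1) * ((2:ℝ)⁻¹ * (k:ℝ)^(-((k:ℝ)-1)) * n) =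
            ((k:ℝ)^((k:ℝ)-1) * (k:ℝ)^(-((k:ℝ)-1))) * n by ring, h4, one_mul]
      _ ≤ Ad * cnorm n k u ((k:ℝ)-1) := by gcongr
      _ = Ad * (linkDist n k u k * cnorm n k u k) := by rw [hD]
      _ ≤ Ad * (linkDist n k u k * (2 * K * Real.log n)) := by gcongr; exact hi u
      _ = Ad * (2 * K) * (Real.log n * linkDist n k u k) := by ring
      _ ≤ A * (Real.log n * linkDist n k u k) := by
          apply mul_le_mul_of_nonneg_right (by linarith); positivity
      _ = _ := by ring
  · intro u
    have h := cnorm_le n k hk u ((k:ℝ)-1) (by linarith)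
    simp only [sub_self, Real.rpow_zero, Finset.sum_const, Nat.card_Icc, Nat.add_sub_cancel,
      nsmul_eq_mul, mul_one] at h
    rw [linkDist_eq, ← mul_div_assoc, div_le_iff₀ (cp u _)]
    calc Real.log n * cnorm n k u ((k:ℝ)-1) ≤ (Ab * cnorm n k u k) * (K * n) := by
          apply mul_le_mul (lo u) h (cp u _).le
          exact mul_nonneg hAbp.le (cp u _).le
      _ = (Ab * K) * (n * cnorm n k u k) := by ring
      _ ≤ A * (n * cnorm n k u k) := by
          apply mul_le_mul_of_nonneg_right (by linarith)
          exact mul_nonneg hn0.le (cp u _).le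
      _ = _ := by ring
  · intro u s hs
    rw [linkDist_eq, hx4]
    have h := cnorm_le n k hk u ((k:ℝ)-1+γ) (by linarith)
    have e : ∀ j : ℕ, (j:ℝ)^((k:ℝ)-1-((k:ℝ)-1+γ)) = (j:ℝ)^(-γ) := by
      intro j; congr 1; ring
    simp only [e] at h
    have h2 := sum_rpow_neg_le γ h0 h1 n
    have h3 := cnorm_anti n k u ((k:ℝ)-1+γ) (s-1) (by linarith)
    have h4 : (n:ℝ)^(1-γ) = n * (n:ℝ)^(-γ) := by
      rw [sub_eq_add_neg, Real.rpow_add hn0, Real.rpow_one]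
    calc cnorm n k u (s-1) / cnorm n k u s ≤ cnorm n k u (s-1) :=
          div_le_self (cp u _).le (c1 u _)
      _ ≤ K * (2 * (n:ℝ)^(1-γ)) := by
          refine h3.trans (h.trans ?_); gcongr
      _ = 2 * K * (n * (n:ℝ)^(-γ)) := by rw [h4]; ring
      _ ≤ A * (n * (n:ℝ)^(-γ)) := by
          apply mul_le_mul_of_nonneg_right (by linarith); positivity
      _ = _ := by ring
  · intro u s
    have : linkDist n k u s ≤ k * n := by
      rw [linkDist_eq, div_le_iff₀ (cp u _), cnorm, cnorm, Finset.mul_sum]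
      refine Finset.sum_le_sum (fun v hv => ?_)
      have hd := dM_pos (mem_others.1 hv)
      have hd0 : (0:ℝ) < dM n k u v := by exact_mod_cast hd
      have hle : (dM n k u v : ℝ) ≤ k * n := by exact_mod_cast dM_le u v
      rw [neg_sub, sub_eq_add_neg, Real.rpow_add hd0, Real.rpow_one]
      gcongr
    refine this.trans (mul_le_mul_of_nonneg_right (by linarith) hn0.le)
  · intro u s hs
    rw [hx4]
    have h := cnorm_ge_triv n k (by omega) hk u ((k:ℝ)-γ) (by linarith)
    have h4 : (k:ℝ)^((k:ℝ)-γ) * (k:ℝ)^(-((k:ℝ)-γ)) = 1 := by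
      rw [← Real.rpow_add hk0]; simp
    have e : (n:ℝ)^((k:ℝ)-((k:ℝ)-γ)) = (n:ℝ)^γ := by
      rw [sub_sub_cancel]
    rw [e] at h
    have h5 : (n:ℝ)^(-γ) * (n:ℝ)^γ = 1 := by rw [← Real.rpow_add hn0]; simp
    have h6 := cnorm_anti n k u s _ hs
    calc (1:ℝ) = Ah * (n:ℝ)^(-γ) * ((2:ℝ)⁻¹ * (k:ℝ)^(-((k:ℝ)-γ)) * (n:ℝ)^γ) := by
          rw [hAh, show 2 * (k:ℝ)^((k:ℝ)-γ) * (n:ℝ)^(-γ) * ((2:ℝ)⁻¹ * (k:ℝ)^(-((k:ℝ)-γ)) * (n:ℝ)^γ) =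
            ((k:ℝ)^((k:ℝ)-γ) * (k:ℝ)^(-((k:ℝ)-γ))) * ((n:ℝ)^(-γ) * (n:ℝ)^γ) by ring, h4, h5, one_mul]
      _ ≤ Ah * (n:ℝ)^(-γ) * cnorm n k u s := by
          apply mul_le_mul_of_nonneg_left (h.trans h6); positivity
      _ ≤ _ := by
          apply mul_le_mul_of_nonneg_right _ (cp u _).le
          apply mul_le_mul_of_nonneg_right (by linarith); positivity

end DRB
namespace DRB

lemma sigma_cases (k g : ℕ) (hg : 2 ≤ g) (s : ℝ) (h : InSigma (g:ℝ)⁻¹ s) :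
    s ≤ (k:ℝ) - (g:ℝ)⁻¹ ∨ s = k ∨ (k:ℝ) + (g:ℝ)⁻¹ ≤ s := by
  obtain ⟨m, rfl⟩ := h
  have hg0 : (0:ℝ) < g := by exact_mod_cast (by omega : 0 < g)
  have hgi : 0 < (g:ℝ)⁻¹ := by positivity
  have e : (k:ℝ) = (k:ℝ) * g * (g:ℝ)⁻¹ := by field_simp
  rcases lt_trichotomy m (k * g) with h | h | h
  · left
    have h' : (m:ℝ) + 1 ≤ (k:ℝ) * g := by exact_mod_cast h
    nlinarith
  · right; left
    rw [h]; push_cast; exact e.symm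
  · right; right
    have h' : (k:ℝ) * g + 1 ≤ m := by exact_mod_cast h
    nlinarith

lemma sigma_nonneg (g : ℕ) (s : ℝ) (h : InSigma (g:ℝ)⁻¹ s) : 0 ≤ s := by
  obtain ⟨m, rfl⟩ := h
  positivity

lemma sigma_nat (g m : ℕ) (hg : 2 ≤ g) : InSigma (g:ℝ)⁻¹ (m:ℝ) := by
  refine ⟨m * g, ?_⟩
  have hg0 : (0:ℝ) < g := by exact_mod_cast (by omega : 0 < g)
  push_cast
  field_simp

section
variable {n k : ℕ}

lemma cnorm_nonneg (u : Node n k) (s : ℝ) : 0 ≤ cnorm n k u s :=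
  Finset.sum_nonneg (fun _ _ => by positivity)

lemma p_nonneg (u v : Node n k) (s : ℝ) : 0 ≤ linkProb n k u v s :=
  div_nonneg (by positivity) (cnorm_nonneg u s)

lemma D_nonneg (u : Node n k) (s : ℝ) : 0 ≤ linkDist n k u s :=
  Finset.sum_nonneg (fun v _ => mul_nonneg (p_nonneg u v s) (by positivity))

lemma recip_nonneg (r : Node n k → ℝ) (u : Node n k) : 0 ≤ recip n k r u :=
  Finset.sum_nonneg (fun v _ => mul_nonneg (p_nonneg u v _) (p_nonneg v u _))

lemma payoff_nonneg (r : Node n k → ℝ) (u : Node n k) : 0 ≤ payoff n k r u :=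
  mul_nonneg (D_nonneg u _) (recip_nonneg r u)

lemma p_sum (hn : 2 ≤ n) (hk : 1 ≤ k) (u : Node n k) (s : ℝ) :
    ∑ v ∈ others n k u, linkProb n k u v s = 1 := by
  unfold linkProb
  rw [← Finset.sum_div]
  have := cnorm_ge_one n k hn hk u s
  exact div_self (by change cnorm n k u s ≠ 0; linarith)

lemma p_le_one (hn : 2 ≤ n) (hk : 1 ≤ k) (u v : Node n k) (hv : v ≠ u) (s : ℝ) :
    linkProb n k u v s ≤ 1 := by
  rw [← p_sum hn hk u s]
  exact Finset.single_le_sum (f := fun v => linkProb n k u v s) (fun _ _ => p_nonneg _ _ _)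
    (mem_others.2 hv)

lemma p_le (hn : 2 ≤ n) (hk : 1 ≤ k) (u v : Node n k) (hv : v ≠ u) (s B : ℝ) (hs : 0 ≤ s)
    (hB : 1 ≤ B * cnorm n k u s) : linkProb n k u v s ≤ B := by
  unfold linkProb
  have := cnorm_ge_one n k hn hk u s
  rw [div_le_iff₀ (by linarith)]
  refine le_trans ?_ hB
  apply Real.rpow_le_one_of_one_le_of_nonpos
  · exact_mod_cast dM_pos hv
  · linarith

lemma recip_le_one (hn : 2 ≤ n) (hk : 1 ≤ k) (r : Node n k → ℝ) (u : Node n k) :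
    recip n k r u ≤ 1 := by
  rw [← p_sum hn hk u (r u)]
  refine Finset.sum_le_sum (fun v hv => ?_)
  exact mul_le_of_le_one_right (p_nonneg _ _ _)
    (p_le_one hn hk v u (Ne.symm (mem_others.1 hv)) _)

lemma payoff_ge (r : Node n k → ℝ) (u v : Node n k) (hv : v ≠ u) :
    linkDist n k u (r u) * (linkProb n k u v (r u) * linkProb n k v u (r v)) ≤ payoff n k r u := by
  unfold payoff
  apply mul_le_mul_of_nonneg_left _ (D_nonneg _ _)
  exact Finset.single_le_sum (f := fun v => linkProb n k u v (r u) * linkProb n k v u (r v))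
    (fun v _ => mul_nonneg (p_nonneg _ _ _) (p_nonneg _ _ _)) (mem_others.2 hv)

lemma payoff_eq (r : Node n k → ℝ) (u : Node n k) : payoff n k r u =
    ∑ v ∈ others n k u,
      linkDist n k u (r u) * (linkProb n k u v (r u) * linkProb n k v u (r v)) := by
  unfold payoff recip
  rw [Finset.mul_sum]

/-- total number of nodes, as a real number -/
def Ncard (n k : ℕ) : ℝ := ∑ _u : Node n k, (1:ℝ)

lemma sum_p (hn : 2 ≤ n) (hk : 1 ≤ k) (r : Node n k → ℝ) :
    ∑ u, ∑ v ∈ others n k u, linkProb n k u v (r u) = Ncard n k :=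
  Finset.sum_congr rfl (fun u _ => p_sum hn hk u (r u))

lemma sum_p' (hn : 2 ≤ n) (hk : 1 ≤ k) (r : Node n k → ℝ) :
    ∑ u, ∑ v ∈ others n k u, linkProb n k v u (r v) = Ncard n k := by
  rw [← sum_p hn hk r]
  apply Finset.sum_comm'
  intro x y
  simp only [Finset.mem_univ, mem_others, true_and, and_true]
  exact ne_comm

lemma pk_le {γ A L x : ℝ} (hn : 2 ≤ n) (hk : 1 ≤ k) (E : Est n k γ A L x) (u v : Node n k) :
    linkProb n k u v k ≤ A / L * (dM n k u v : ℝ)^(-(k:ℝ)) := by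
  have hA := E.hA
  have hL := E.hL
  have h := E.ck_lo u
  have hc := cnorm_ge_one n k hn hk u k
  unfold linkProb
  rw [div_le_iff₀ (by linarith)]
  have hd : 0 ≤ (dM n k u v : ℝ)^(-(k:ℝ)) := by positivity
  have h1 : 1 ≤ A / L * cnorm n k u k := by
    rw [div_mul_eq_mul_div, le_div_iff₀ (by linarith)]; linarith
  calc _ = 1 * (dM n k u v : ℝ)^(-(k:ℝ)) := by ring
    _ ≤ (A / L * cnorm n k u k) * (dM n k u v : ℝ)^(-(k:ℝ)) := by gcongr
    _ = _ := by ring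

lemma pk_ge {γ A L x : ℝ} (hn : 2 ≤ n) (hk : 1 ≤ k) (E : Est n k γ A L x) (u v : Node n k) :
    (A * L)⁻¹ * (dM n k u v : ℝ)^(-(k:ℝ)) ≤ linkProb n k u v k := by
  have hA := E.hA
  have hL := E.hL
  have hc := cnorm_ge_one n k hn hk u k
  unfold linkProb
  rw [div_eq_inv_mul]
  have hd : 0 ≤ (dM n k u v : ℝ)^(-(k:ℝ)) := by positivity
  have := E.ck_hi u
  gcongr

lemma Dk_ge {γ A L x : ℝ} (E : Est n k γ A L x) (u : Node n k) :
    n / (A * L) ≤ linkDist n k u k := by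
  have hA := E.hA
  have hL := E.hL
  rw [div_le_iff₀ (by nlinarith)]
  linarith [E.Dk_lo u]

lemma Dk_le {γ A L x : ℝ} (E : Est n k γ A L x) (u : Node n k) :
    linkDist n k u k ≤ A * n / L := by
  have hL := E.hL
  rw [le_div_iff₀ (by linarith)]
  linarith [E.Dk_hi u]

lemma mul3_le {a b c a' b' c' : ℝ} (ha : 0 ≤ a) (hb : 0 ≤ b) (hc : 0 ≤ c)
    (h1 : a ≤ a') (h2 : b ≤ b') (h3 : c ≤ c') : a * (b * c) ≤ a' * (b' * c') := by
  have : 0 ≤ a' := ha.trans h1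
  have : 0 ≤ b' := hb.trans h2
  gcongr

lemma x4_le {x : ℝ} (hx : 0 < x) (hx1 : x ≤ 1) : x^4 ≤ x := by
  calc x^4 ≤ x^1 := pow_le_pow_of_le_one hx.le hx1 (by norm_num)
    _ = x := pow_one x

lemma A_pow {A : ℝ} (hA : 1 ≤ A) {i j : ℕ} (h : i ≤ j) : A^i ≤ A^j := pow_le_pow_right₀ hA h

/-- terms with `r u > k` -/
lemma term_hi {γ A L x : ℝ} (hn : 2 ≤ n) (hk : 1 ≤ k) (E : Est n k γ A L x) (u v : Node n k)
    (hv : v ≠ u) (s t : ℝ) (hs : (k:ℝ) + γ ≤ s) :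
    linkDist n k u s * (linkProb n k u v s * linkProb n k v u t) ≤
      A^3 * n * x * linkProb n k u v s := by
  have hA := E.hA
  have hx := E.hx
  have hp := p_nonneg u v s
  have h := mul3_le (D_nonneg u s) hp (p_nonneg v u t) (E.Dhi u s hs) le_rfl
    (p_le_one hn hk v u hv.symm t)
  refine h.trans ?_
  have := x4_le hx E.hx1
  have hA3 : A ≤ A^3 := by simpa using A_pow hA (show 1 ≤ 3 by norm_num)
  rw [mul_one]
  gcongr

/-- terms with `r u < k` -/
lemma term_lo {γ A L x : ℝ} (hn : 2 ≤ n) (hk : 1 ≤ k) (E : Est n k γ A L x) (u v : Node n k)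
    (hv : v ≠ u) (s t : ℝ) (hs0 : 0 ≤ s) (hs : s ≤ (k:ℝ) - γ) :
    linkDist n k u s * (linkProb n k u v s * linkProb n k v u t) ≤
      A^3 * n * x * linkProb n k v u t := by
  have hA := E.hA
  have hx := E.hx
  have hp := p_nonneg v u t
  have h := mul3_le (D_nonneg u s) (p_nonneg u v s) hp (E.Dtriv u s)
    (p_le hn hk u v hv s _ hs0 (E.clo u s hs)) le_rfl
  refine h.trans ?_
  have := x4_le hx E.hx1
  have hA3 : A^2 ≤ A^3 := A_pow hA (show 2 ≤ 3 by norm_num)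
  calc A * n * (A * x^4 * linkProb n k v u t) = A^2 * n * x^4 * linkProb n k v u t := by ring
    _ ≤ _ := by gcongr

lemma sw_le {A L x : ℝ} (g : ℕ) (hg : 2 ≤ g) (hn : 2 ≤ n) (hk : 1 ≤ k)
    (E : Est n k (g:ℝ)⁻¹ A L x) (hxL : x * L^3 ≤ 1)
    (r : Node n k → ℝ) (hr : ValidProfile n k (g:ℝ)⁻¹ r) :
    ∑ u, payoff n k r u ≤ (2 * A^3 + A^2) * (Ncard n k * n / L^2) := by
  have hA := E.hA
  have hx := E.hx
  have hL := E.hL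
  have hL0 : 0 < L := by linarith
  have hNn : 0 ≤ Ncard n k := Finset.sum_nonneg (fun _ _ => by norm_num)
  have key : ∀ u, ∀ v ∈ others n k u,
      linkDist n k u (r u) * (linkProb n k u v (r u) * linkProb n k v u (r v)) ≤
        A^3 * n * x * linkProb n k u v (r u) + (A^3 * n * x + A^2 * n / L^2) *
          linkProb n k v u (r v) := by
    intro u v hv
    rw [mem_others] at hv
    have h1 := p_nonneg u v (r u)
    have h2 := p_nonneg v u (r v)
    have n1 : 0 ≤ A^3 * n * x * linkProb n k u v (r u) := by positivity
    have n2 : 0 ≤ A^3 * n * x * linkProb n k v u (r v) := by positivity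
    have n3 : 0 ≤ A^2 * n / L^2 * linkProb n k v u (r v) := by positivity
    rw [add_mul]
    rcases sigma_cases k g hg (r u) (hr u) with h | h | h
    · have := term_lo hn hk E u v hv (r u) (r v) (sigma_nonneg g _ (hr u)) h
      linarith
    · rw [h] at h1 n1 ⊢
      have hp : linkProb n k u v k ≤ A / L := p_le hn hk u v hv k _ (by positivity) (by
        rw [div_mul_eq_mul_div, le_div_iff₀ hL0]; linarith [E.ck_lo u])
      have := mul3_le (D_nonneg u k) h1 h2 (Dk_le E u) hp le_rfl
      have e : A * n / L * (A / L * linkProb n k v u (r v)) =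
        A^2 * n / L^2 * linkProb n k v u (r v) := by field_simp
      linarith
    · have := term_hi hn hk E u v hv (r u) (r v) h
      linarith
  calc ∑ u, payoff n k r u ≤ ∑ u, ∑ v ∈ others n k u, (A^3 * n * x * linkProb n k u v (r u) +
        (A^3 * n * x + A^2 * n / L^2) * linkProb n k v u (r v)) := by
        refine Finset.sum_le_sum (fun u _ => ?_)
        rw [payoff_eq]
        exact Finset.sum_le_sum (key u)
    _ = A^3 * n * x * Ncard n k + (A^3 * n * x + A^2 * n / L^2) * Ncard n k := by
        simp only [Finset.sum_add_distrib, ← Finset.mul_sum]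
        rw [sum_p hn hk, sum_p' hn hk]
    _ ≤ A^3 * n * (1 / L^2) * Ncard n k + (A^3 * n * (1 / L^2) + A^2 * n / L^2) * Ncard n k := by
        have : x ≤ 1 / L^2 := by
          rw [le_div_iff₀ (by positivity)]
          have : L^2 ≤ L^3 := pow_le_pow_right₀ hL (by norm_num)
          nlinarith
        gcongr
    _ = _ := by ring

lemma nash_pair {A L x : ℝ} (g : ℕ) (hg : 2 ≤ g) (hn : 2 ≤ n) (hk : 1 ≤ k)
    (E : Est n k (g:ℝ)⁻¹ A L x) (hxL : x * L^3 ≤ 1)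
    (r : Node n k → ℝ) (hN : IsNash n k (g:ℝ)⁻¹ r) (u v : Node n k)
    (hv : v ≠ u) (hu : r u = k) (hrv : (k:ℝ) + (g:ℝ)⁻¹ ≤ r v) :
    linkProb n k u v k ≤ A^2 * x := by
  have hA := E.hA
  have hx := E.hx
  have hL := E.hL
  have hL0 : 0 < L := by linarith
  have hn0 : (0:ℝ) < n := by exact_mod_cast (by omega : 0 < n)
  have h1 : payoff n k r v ≤ A * n * x^4 := by
    unfold payoff
    have := recip_le_one hn hk r v
    have h2 := D_nonneg v (r v)
    nlinarith [E.Dhi v (r v) hrv]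
  have h2 := hN v k (sigma_nat g k hg)
  have h3 := payoff_ge (Function.update r v k) v u hv.symm
  rw [Function.update_self, Function.update_of_ne hv.symm, hu] at h3
  have h4 : linkDist n k v k * (linkProb n k v u k * linkProb n k u v k) ≤ A * n * x^4 := by
    linarith
  have h5 : A^(-2 : ℤ) * linkProb n k u v k ≤ linkProb n k v u k := by
    refine le_trans ?_ (pk_ge hn hk E v u)
    rw [dM_comm n k v u]
    calc A^(-2 : ℤ) * linkProb n k u v k ≤ A^(-2 : ℤ) * (A / L * (dM n k u v : ℝ)^(-(k:ℝ))) := by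
          have := pk_le hn hk E u v
          gcongr
      _ = _ := by
        have : A ≠ 0 := by positivity
        field_simp
  have hp := p_nonneg u v k
  have h6 : n / (A * L) * (A^(-2 : ℤ) * linkProb n k u v k * linkProb n k u v k) ≤ A * n * x^4 := by
    refine le_trans ?_ h4
    refine mul3_le (by positivity) (by positivity) hp (Dk_ge E v) h5 le_rfl
  have e : n / (A * L) * (A^(-2 : ℤ) * linkProb n k u v k * linkProb n k u v k) =
      n * (linkProb n k u v k)^2 / (A^3 * L) := by
    have : A ≠ 0 := by positivity
    field_simp
  rw [e, div_le_iff₀ (by positivity)] at h6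
  have h7 : (linkProb n k u v k)^2 ≤ A^4 * (L * x^4) := by
    have : n * (linkProb n k u v k)^2 ≤ n * (A^4 * (L * x^4)) := by linarith
    exact le_of_mul_le_mul_left this hn0
  have h8 : L * x^4 ≤ x^2 := by
    have a1 : L ≤ L^3 := by simpa using pow_le_pow_right₀ hL (show 1 ≤ 3 by norm_num)
    have a2 : x^4 ≤ x^3 := pow_le_pow_of_le_one hx.le E.hx1 (by norm_num)
    calc L * x^4 ≤ L^3 * x^3 := by gcongr
      _ = (x * L^3) * x^2 := by ring
      _ ≤ 1 * x^2 := by gcongr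
      _ = x^2 := one_mul _
  refine (pow_le_pow_iff_left₀ hp (by positivity) two_ne_zero).1 ?_
  calc (linkProb n k u v k)^2 ≤ A^4 * x^2 := h7.trans (by gcongr)
    _ = (A^2 * x)^2 := by ring

end

end DRB
namespace DRB

lemma nash_sw_le {n k : ℕ} {A L x : ℝ} (g : ℕ) (hg : 2 ≤ g) (hn : 2 ≤ n) (hk : 1 ≤ k)
    (E : Est n k (g:ℝ)⁻¹ A L x) (hxL : x * L^3 ≤ 1)
    (r : Node n k → ℝ) (hr : ValidProfile n k (g:ℝ)⁻¹ r) (hN : IsNash n k (g:ℝ)⁻¹ r) :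
    ∑ u, payoff n k r u ≤ (2 * A^3 + A^4) * (Ncard n k * n / L^3) := by
  have hA := E.hA
  have hx := E.hx
  have hL := E.hL
  have hL0 : 0 < L := by linarith
  have hNn : 0 ≤ Ncard n k := Finset.sum_nonneg (fun _ _ => by norm_num)
  have key : ∀ u, ∀ v ∈ others n k u,
      linkDist n k u (r u) * (linkProb n k u v (r u) * linkProb n k v u (r v)) ≤
        A^3 * n * x * linkProb n k u v (r u) + A^3 * n * x * linkProb n k v u (r v) +
          A^3 * n / L^3 * (dM n k u v : ℝ)^(-(2 * (k:ℝ))) := by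
    intro u v hv
    rw [mem_others] at hv
    have h1 := p_nonneg u v (r u)
    have h2 := p_nonneg v u (r v)
    have n1 : 0 ≤ A^3 * n * x * linkProb n k u v (r u) := by positivity
    have n2 : 0 ≤ A^3 * n * x * linkProb n k v u (r v) := by positivity
    have n3 : 0 ≤ A^3 * n / L^3 * (dM n k u v : ℝ)^(-(2 * (k:ℝ))) := by positivity
    rcases sigma_cases k g hg (r u) (hr u) with h | h | h
    · have := term_lo hn hk E u v hv (r u) (r v) (sigma_nonneg g _ (hr u)) h
      linarith
    · rcases sigma_cases k g hg (r v) (hr v) with h' | h' | h'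
      · have hp := p_le hn hk v u hv.symm (r v) _ (sigma_nonneg g _ (hr v)) (E.clo v _ h')
        have := mul3_le (D_nonneg u (r u)) h1 h2 (E.Dtriv u _) le_rfl hp
        have h4 := x4_le hx E.hx1
        have hA3 : A^2 ≤ A^3 := A_pow hA (show 2 ≤ 3 by norm_num)
        have : A * n * (linkProb n k u v (r u) * (A * x^4)) ≤
            A^3 * n * x * linkProb n k u v (r u) := by
          calc _ = A^2 * n * x^4 * linkProb n k u v (r u) := by ring
            _ ≤ _ := by gcongr
        linarith
      · rw [h] at h1 n1 ⊢
        rw [h'] at h2 n2 ⊢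
        have q1 := pk_le hn hk E u v
        have q2 := pk_le hn hk E v u
        rw [dM_comm n k v u] at q2
        have := mul3_le (D_nonneg u k) h1 h2 (Dk_le E u) q1 q2
        have hd := dM_pos hv
        have hd0 : (0:ℝ) < dM n k u v := by exact_mod_cast hd
        have e : (dM n k u v : ℝ)^(-(2 * (k:ℝ))) =
            (dM n k u v : ℝ)^(-(k:ℝ)) * (dM n k u v : ℝ)^(-(k:ℝ)) := by
          rw [← Real.rpow_add hd0]; congr 1; ring
        have e2 : A * n / L * (A / L * (dM n k u v : ℝ)^(-(k:ℝ)) *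
            (A / L * (dM n k u v : ℝ)^(-(k:ℝ)))) =
            A^3 * n / L^3 * (dM n k u v : ℝ)^(-(2 * (k:ℝ))) := by
          rw [e]; field_simp
        linarith
      · have hp := nash_pair g hg hn hk E hxL r hN u v hv h h'
        rw [h] at h1 n1 ⊢
        have := mul3_le (D_nonneg u k) h1 h2 (E.Dtriv u _) hp le_rfl
        have e : A * n * (A^2 * x * linkProb n k v u (r v)) =
            A^3 * n * x * linkProb n k v u (r v) := by ring
        linarith
    · have := term_hi hn hk E u v hv (r u) (r v) h
      linarith
  calc ∑ u, payoff n k r u ≤ ∑ u, ∑ v ∈ others n k u, (A^3 * n * x * linkProb n k u v (r u) +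
        A^3 * n * x * linkProb n k v u (r v) +
          A^3 * n / L^3 * (dM n k u v : ℝ)^(-(2 * (k:ℝ)))) := by
        refine Finset.sum_le_sum (fun u _ => ?_)
        rw [payoff_eq]
        exact Finset.sum_le_sum (key u)
    _ = A^3 * n * x * Ncard n k + A^3 * n * x * Ncard n k +
          A^3 * n / L^3 * ∑ u : Node n k, cnorm n k u (2 * k) := by
        simp only [Finset.sum_add_distrib, ← Finset.mul_sum]
        rw [sum_p hn hk, sum_p' hn hk]
        rfl
    _ ≤ A^3 * n * (1 / L^3) * Ncard n k + A^3 * n * (1 / L^3) * Ncard n k +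
          A^3 * n / L^3 * (A * Ncard n k) := by
        have hx' : x ≤ 1 / L^3 := by
          rw [le_div_iff₀ (by positivity)]; exact hxL
        have hs : ∑ u : Node n k, cnorm n k u (2 * k) ≤ A * Ncard n k := by
          unfold Ncard
          rw [Finset.mul_sum]
          exact Finset.sum_le_sum (fun u _ => by simpa using E.c2k u)
        gcongr
    _ = _ := by ring

lemma const_payoff_ge {n k : ℕ} {γ A L x : ℝ} (hn : 2 ≤ n) (hk : 1 ≤ k)
    (E : Est n k γ A L x) (u : Node n k) :
    n / (A^3 * L^3) ≤ payoff n k (fun _ => (k:ℝ)) u := by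
  have hA := E.hA
  have hL := E.hL
  obtain ⟨v, hv, hd, _⟩ := exists_nbr n k hn hk u
  refine le_trans ?_ (payoff_ge (fun _ => (k:ℝ)) u v hv)
  have q1 := pk_ge hn hk E u v
  have q2 := pk_ge hn hk E v u
  rw [dM_comm n k v u] at q2
  simp only [hd, Nat.cast_one, Real.one_rpow, mul_one] at q1 q2
  have := mul3_le (by positivity) (by positivity) (by positivity) (Dk_ge E u) q1 q2
  refine le_trans (le_of_eq ?_) this
  have : A ≠ 0 := by positivity
  have : L ≠ 0 := by positivity
  field_simp

lemma const_nash {n k : ℕ} {A L x : ℝ} (g : ℕ) (hg : 2 ≤ g) (hn : 2 ≤ n) (hk : 1 ≤ k)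
    (E : Est n k (g:ℝ)⁻¹ A L x) (hxL : A^7 * (x * L^3) ≤ 1) :
    IsNash n k (g:ℝ)⁻¹ (fun _ => (k:ℝ)) := by
  intro u s hs
  have hA := E.hA
  have hx := E.hx
  have hL := E.hL
  have hL0 : 0 < L := by linarith
  have h0 := const_payoff_ge hn hk E u
  have hx4 := x4_le hx E.hx1
  have hfin : A^4 * n * x ≤ n / (A^3 * L^3) := by
    rw [le_div_iff₀ (by positivity)]
    calc A^4 * n * x * (A^3 * L^3) = (A^7 * (x * L^3)) * n := by ring
      _ ≤ 1 * (n:ℝ) := by gcongr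
      _ = (n:ℝ) := one_mul _
  rcases sigma_cases k g hg s hs with h | h | h
  · refine ge_iff_le.2 (le_trans ?_ (hfin.trans h0))
    unfold payoff recip
    rw [Function.update_self]
    have hrec : ∑ v ∈ others n k u, linkProb n k u v s *
        linkProb n k v u (Function.update (fun _ => (k:ℝ)) u s v) ≤
        ∑ v ∈ others n k u, (A * x^4) * (A / L * (dM n k u v : ℝ)^(-(k:ℝ))) := by
      refine Finset.sum_le_sum (fun v hv => ?_)
      rw [mem_others] at hv
      rw [Function.update_of_ne hv]
      have q2 := pk_le hn hk E v u
      rw [dM_comm n k v u] at q2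
      exact mul_le_mul (p_le hn hk u v hv s _ (sigma_nonneg g _ hs) (E.clo u s h)) q2
        (p_nonneg _ _ _) (by positivity)
    have hrec2 : ∑ v ∈ others n k u, (A * x^4) * (A / L * (dM n k u v : ℝ)^(-(k:ℝ))) ≤
        A^3 * x^4 := by
      simp only [← Finset.mul_sum]
      calc A * x^4 * (A / L * cnorm n k u k) ≤ A * x^4 * (A / L * (A * L)) := by
            have := E.ck_hi u
            gcongr
        _ = A^3 * x^4 := by field_simp
    calc _ ≤ (A * n) * (A^3 * x^4) :=
          mul_le_mul (E.Dtriv u s) (hrec.trans hrec2)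
            (Finset.sum_nonneg (fun v _ => mul_nonneg (p_nonneg _ _ _) (p_nonneg _ _ _)))
            (by positivity)
      _ = A^4 * n * x^4 := by ring
      _ ≤ _ := by gcongr
  · subst h
    have : Function.update (fun _ : Node n k => (k:ℝ)) u (k:ℝ) = fun _ => (k:ℝ) :=
      Function.update_eq_self u (fun _ : Node n k => (k:ℝ))
    rw [this]
  · refine ge_iff_le.2 (le_trans ?_ (hfin.trans h0))
    unfold payoff
    rw [Function.update_self]
    have hA4 : A ≤ A^4 := by simpa using A_pow hA (show 1 ≤ 4 by norm_num)
    calc _ ≤ (A * n * x^4) * 1 :=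
          mul_le_mul (E.Dhi u s h) (recip_le_one hn hk _ u) (recip_nonneg _ u) (by positivity)
      _ ≤ _ := by rw [mul_one]; gcongr

lemma const_sw_ge {n k : ℕ} {γ A L x : ℝ} (hn : 2 ≤ n) (hk : 1 ≤ k)
    (E : Est n k γ A L x) :
    (A^3)⁻¹ * (Ncard n k * n / L^3) ≤ ∑ u, payoff n k (fun _ => (k:ℝ)) u := by
  calc (A^3)⁻¹ * (Ncard n k * n / L^3) = ∑ u : Node n k, n / (A^3 * L^3) := by
        unfold Ncard
        rw [Finset.sum_mul, Finset.sum_div, Finset.mul_sum]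
        refine Finset.sum_congr rfl (fun u _ => ?_)
        rw [one_mul, ← div_eq_inv_mul, div_div, mul_comm (L^3)]
    _ ≤ _ := Finset.sum_le_sum (fun u _ => const_payoff_ge hn hk E u)

/-- Alternating profile. -/
def alt (n k : ℕ) (hk : 1 ≤ k) (b : ℕ) : Node n k → ℝ :=
  fun u => if ((u ⟨0, hk⟩ : Fin n) : ℕ) % 2 = b then (k:ℝ) else 2 * k

lemma alt_valid (n k g : ℕ) (hg : 2 ≤ g) (hk : 1 ≤ k) (b : ℕ) :
    ValidProfile n k (g:ℝ)⁻¹ (alt n k hk b) := by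
  intro u
  unfold alt
  split_ifs
  · exact sigma_nat g k hg
  · have := sigma_nat g (2 * k) hg
    push_cast at this
    exact this

lemma alt_payoff_ge {n k : ℕ} {γ A L x : ℝ} (hn : 2 ≤ n) (hk : 1 ≤ k)
    (E : Est n k γ A L x) (b : ℕ) (u : Node n k) (hu : ((u ⟨0, hk⟩ : Fin n) : ℕ) % 2 = b) :
    n / (A^3 * L^2) ≤ payoff n k (alt n k hk b) u := by
  have hA := E.hA
  have hL := E.hL
  obtain ⟨v, hv, hd, hpar⟩ := exists_nbr n k hn hk u
  have h := payoff_ge (alt n k hk b) u v hv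
  have ru : alt n k hk b u = k := by simp only [alt]; rw [if_pos hu]
  have rv : alt n k hk b v = 2 * k := by
    simp only [alt]; rw [if_neg]; rw [← hu]; exact hpar
  rw [ru, rv] at h
  refine le_trans ?_ h
  have q1 := pk_ge hn hk E u v
  simp only [hd, Nat.cast_one, Real.one_rpow, mul_one] at q1
  have q2 : A⁻¹ ≤ linkProb n k v u (2 * k) := by
    have hc := cnorm_ge_one n k hn hk v (2*k)
    unfold linkProb
    rw [dM_comm n k v u, hd, Nat.cast_one, Real.one_rpow, one_div]
    have := E.c2k v
    gcongr
  have := mul3_le (by positivity) (by positivity) (by positivity) (Dk_ge E u) q1 q2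
  refine le_trans (le_of_eq ?_) this
  have : A ≠ 0 := by positivity
  have : L ≠ 0 := by positivity
  field_simp

lemma alt_sw_ge {n k : ℕ} {γ A L x : ℝ} (hn : 2 ≤ n) (hk : 1 ≤ k)
    (E : Est n k γ A L x) :
    (A^3)⁻¹ * (Ncard n k * n / L^2) ≤
      ∑ u, payoff n k (alt n k hk 0) u + ∑ u, payoff n k (alt n k hk 1) u := by
  calc (A^3)⁻¹ * (Ncard n k * n / L^2) = ∑ u : Node n k, n / (A^3 * L^2) := by
        unfold Ncard
        rw [Finset.sum_mul, Finset.sum_div, Finset.mul_sum]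
        refine Finset.sum_congr rfl (fun u _ => ?_)
        rw [one_mul, ← div_eq_inv_mul, div_div, mul_comm (L^2)]
    _ ≤ _ := by
        rw [← Finset.sum_add_distrib]
        refine Finset.sum_le_sum (fun u _ => ?_)
        have h0 := payoff_nonneg (alt n k hk 0) u
        have h1 := payoff_nonneg (alt n k hk 1) u
        rcases Nat.mod_two_eq_zero_or_one ((u ⟨0, hk⟩ : Fin n) : ℕ) with h | h
        · linarith [alt_payoff_ge hn hk E 0 u h]
        · linarith [alt_payoff_ge hn hk E 1 u h]

lemma eventually_small (γ : ℝ) (h0 : 0 < γ) (B : ℝ) (hB : 0 < B) :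
    ∃ n0 : ℕ, ∀ n : ℕ, n0 ≤ n → B * ((n:ℝ)^(-γ/4) * (Real.log n)^3) ≤ 1 := by
  have h := (isLittleO_log_rpow_rpow_atTop 3 (show 0 < γ/4 by positivity)).def
    (show 0 < B⁻¹ by positivity)
  have h2 := tendsto_natCast_atTop_atTop (R := ℝ) |>.eventually h
  obtain ⟨n0, hn0⟩ := Filter.eventually_atTop.1 h2
  refine ⟨max n0 1, fun n hn => ?_⟩
  have h3 := hn0 n (le_trans (le_max_left _ _) hn)
  have hn1 : (1:ℝ) ≤ n := by exact_mod_cast le_trans (le_max_right _ _) hn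
  have hnp : (0:ℝ) < n := by linarith
  have hl : 0 ≤ Real.log n := Real.log_nonneg hn1
  rw [Real.norm_of_nonneg (by positivity), Real.norm_of_nonneg (by positivity)] at h3
  have e : (Real.log n)^(3:ℝ) = (Real.log n)^3 := by
    rw [← Real.rpow_natCast]; norm_num
  rw [e] at h3
  have e2 : (n:ℝ)^(-γ/4) * (n:ℝ)^(γ/4) = 1 := by
    rw [← Real.rpow_add hnp]
    rw [show -γ/4 + γ/4 = 0 by ring, Real.rpow_zero]
  calc B * ((n:ℝ)^(-γ/4) * (Real.log n)^3) ≤ B * ((n:ℝ)^(-γ/4) * (B⁻¹ * (n:ℝ)^(γ/4))) := by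
        gcongr
    _ = (B * B⁻¹) * ((n:ℝ)^(-γ/4) * (n:ℝ)^(γ/4)) := by ring
    _ = 1 := by rw [e2, mul_inv_cancel₀ hB.ne', one_mul]

end DRB

/-- The price of stability of the DRB game is `Θ(ln n)`:
`PoS = (sup of social welfare over valid profiles) /
(sup of social welfare over Nash equilibria)` satisfies
`c1·ln n ≤ PoS ≤ c2·ln n` for all large `n`. -/
theorem price_of_stability (k g : ℕ) (hk : 1 ≤ k) (hg : 2 ≤ g) :
    ∃ c1 c2 : ℝ, 0 < c1 ∧ 0 < c2 ∧ ∃ n0 : ℕ, ∀ n : ℕ, n0 ≤ n →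
      c1 * Real.log n ≤
        (sSup {x : ℝ | ∃ r : DRB.Node n k → ℝ,
            DRB.ValidProfile n k (g : ℝ)⁻¹ r ∧ x = ∑ u, DRB.payoff n k r u}) /
        (sSup {x : ℝ | ∃ r : DRB.Node n k → ℝ,
            DRB.ValidProfile n k (g : ℝ)⁻¹ r ∧ DRB.IsNash n k (g : ℝ)⁻¹ r ∧
            x = ∑ u, DRB.payoff n k r u}) ∧
      (sSup {x : ℝ | ∃ r : DRB.Node n k → ℝ,
          DRB.ValidProfile n k (g : ℝ)⁻¹ r ∧ x = ∑ u, DRB.payoff n k r u}) /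
        (sSup {x : ℝ | ∃ r : DRB.Node n k → ℝ,
            DRB.ValidProfile n k (g : ℝ)⁻¹ r ∧ DRB.IsNash n k (g : ℝ)⁻¹ r ∧
            x = ∑ u, DRB.payoff n k r u}) ≤ c2 * Real.log n := by
  have hg2 : (2:ℝ) ≤ g := by exact_mod_cast hg
  have hγ0 : (0:ℝ) < (g:ℝ)⁻¹ := by positivity
  have hγ1 : (g:ℝ)⁻¹ ≤ 1/2 := by
    rw [one_div]; gcongr
  obtain ⟨A, hA, hE⟩ := DRB.exists_est k hk (g:ℝ)⁻¹ hγ0 hγ1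
  obtain ⟨n1, hn1⟩ := DRB.eventually_small (g:ℝ)⁻¹ hγ0 (A^7) (by positivity)
  refine ⟨(2 * A^3)⁻¹ / (2 * A^3 + A^4), (2 * A^3 + A^2) / (A^3)⁻¹, by positivity, by positivity,
    max n1 4, fun n hn => ?_⟩
  have hn4 : 4 ≤ n := le_trans (le_max_right _ _) hn
  have hn2 : 2 ≤ n := by omega
  have E := hE n hn4
  have hx7 := hn1 n (le_trans (le_max_left _ _) hn)
  set L := Real.log n with hLdef
  set x := (n:ℝ)^(-(g:ℝ)⁻¹/4) with hxdef
  have hL := E.hL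
  have hx := E.hx
  have hL0 : 0 < L := by linarith
  have hn0 : (0:ℝ) < n := by exact_mod_cast (by omega : 0 < n)
  have hxL : x * L^3 ≤ 1 := by
    have h1 : 1 ≤ A^7 := one_le_pow₀ hA
    have h2 : 0 ≤ x * L^3 := by positivity
    nlinarith
  have hNp : 0 < DRB.Ncard n k := by
    have : Nonempty (DRB.Node n k) := ⟨fun _ => ⟨0, by omega⟩⟩
    exact Finset.sum_pos (fun _ _ => one_pos) Finset.univ_nonempty
  set S1 := {x : ℝ | ∃ r : DRB.Node n k → ℝ,
            DRB.ValidProfile n k (g : ℝ)⁻¹ r ∧ x = ∑ u, DRB.payoff n k r u} with hS1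
  set S2 := {x : ℝ | ∃ r : DRB.Node n k → ℝ,
            DRB.ValidProfile n k (g : ℝ)⁻¹ r ∧ DRB.IsNash n k (g : ℝ)⁻¹ r ∧
            x = ∑ u, DRB.payoff n k r u} with hS2
  have u1 : ∀ y ∈ S1, y ≤ (2 * A^3 + A^2) * (DRB.Ncard n k * n / L^2) := by
    rintro y ⟨r, hr, rfl⟩
    exact DRB.sw_le g hg hn2 hk E hxL r hr
  have u2 : ∀ y ∈ S2, y ≤ (2 * A^3 + A^4) * (DRB.Ncard n k * n / L^3) := by
    rintro y ⟨r, hr, hN, rfl⟩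
    exact DRB.nash_sw_le g hg hn2 hk E hxL r hr hN
  have b1 : BddAbove S1 := ⟨_, u1⟩
  have b2 : BddAbove S2 := ⟨_, u2⟩
  have m2 : (∑ u, DRB.payoff n k (fun _ => (k:ℝ)) u) ∈ S2 :=
    ⟨_, fun _ => DRB.sigma_nat g k hg, DRB.const_nash g hg hn2 hk E hx7, rfl⟩
  have m10 : (∑ u, DRB.payoff n k (DRB.alt n k hk 0) u) ∈ S1 :=
    ⟨_, DRB.alt_valid n k g hg hk 0, rfl⟩
  have m11 : (∑ u, DRB.payoff n k (DRB.alt n k hk 1) u) ∈ S1 :=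
    ⟨_, DRB.alt_valid n k g hg hk 1, rfl⟩
  have hi1 : sSup S1 ≤ (2 * A^3 + A^2) * (DRB.Ncard n k * n / L^2) := csSup_le ⟨_, m10⟩ u1
  have hi2 : sSup S2 ≤ (2 * A^3 + A^4) * (DRB.Ncard n k * n / L^3) := csSup_le ⟨_, m2⟩ u2
  have lo1 : (2 * A^3)⁻¹ * (DRB.Ncard n k * n / L^2) ≤ sSup S1 := by
    have h := DRB.alt_sw_ge hn2 hk E
    have h1 := le_csSup b1 m10
    have h2 := le_csSup b1 m11
    have e : (2 * A^3)⁻¹ * (DRB.Ncard n k * n / L^2) =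
      ((A^3)⁻¹ * (DRB.Ncard n k * n / L^2)) / 2 := by rw [mul_inv]; ring
    rw [e]; linarith
  have lo2 : (A^3)⁻¹ * (DRB.Ncard n k * n / L^3) ≤ sSup S2 :=
    (DRB.const_sw_ge hn2 hk E).trans (le_csSup b2 m2)
  have hW : 0 < DRB.Ncard n k * n / L^3 := by positivity
  have eW : DRB.Ncard n k * n / L^2 = L * (DRB.Ncard n k * n / L^3) := by field_simp
  rw [eW] at hi1 lo1
  generalize DRB.Ncard n k * n / L^3 = W at *
  have hpos2 : 0 < sSup S2 := lt_of_lt_of_le (by positivity) lo2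
  have hA0 : 0 < A := by linarith
  constructor
  · rw [le_div_iff₀ hpos2]
    calc (2 * A^3)⁻¹ / (2 * A^3 + A^4) * L * sSup S2
        ≤ (2 * A^3)⁻¹ / (2 * A^3 + A^4) * L * ((2 * A^3 + A^4) * W) := by gcongr
      _ = (2 * A^3)⁻¹ * (L * W) := by field_simp
      _ ≤ _ := lo1
  · rw [div_le_iff₀ hpos2]
    calc sSup S1 ≤ (2 * A^3 + A^2) * (L * W) := hi1
      _ = (2 * A^3 + A^2) / (A^3)⁻¹ * L * ((A^3)⁻¹ * W) := by field_simp
      _ ≤ _ := by gcongr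
end
end

section
/- For the DRB game on the k-dimensional grid, there exist constants c1, c2 > 0 and n0 ∈ ℕ (all depending only on k and the granularity γ) such that for all n ≥ n0: the price of anarchy satisfies c1 · n^k/(ln n)^2 ≤ PoA ≤ c2 · n^k/(ln n)^2, where PoA = (max over all profiles r of SW(r)) / (min over Nash equilibria r* of SW(r*)). -/
open Finset

noncomputable section

namespace DRBP
open DRB

/-- Torus norm of an offset vector. -/
def nrm (n k : ℕ) (w : Node n k) : ℕ := ∑ i, min (w i).val (n - (w i).val)

/-- Normalization constant in offset coordinates. -/
def C (n k : ℕ) [NeZero n] (s : ℝ) : ℝ :=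
  ∑ w ∈ univ.filter (fun w : Node n k => w ≠ 0), (nrm n k w : ℝ) ^ (-s)

lemma min_eq (n : ℕ) (a b : Fin n) :
    min ((a : ℤ) - (b : ℤ)).natAbs (n - ((a : ℤ) - (b : ℤ)).natAbs)
      = min (b - a).val (n - (b - a).val) := by
  have ha := a.isLt
  have hb := b.isLt
  have h : (b - a).val = if a.val ≤ b.val then b.val - a.val else n + b.val - a.val := by
    rw [Fin.val_sub]
    split_ifs with h
    · rw [show n - a.val + b.val = (b.val - a.val) + n by omega, Nat.add_mod_right,
        Nat.mod_eq_of_lt (by omega)]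
    · rw [Nat.mod_eq_of_lt (by omega)]; omega
  rw [h]
  split_ifs <;> omega

lemma dM_eq (n k : ℕ) (u v : Node n k) : dM n k u v = nrm n k (v - u) := by
  unfold dM nrm
  refine Finset.sum_congr rfl fun i _ => ?_
  rw [min_eq]; rfl

lemma dM_comm (n k : ℕ) (u v : Node n k) : dM n k u v = dM n k v u := by
  unfold dM
  refine Finset.sum_congr rfl fun i _ => ?_
  rw [← Int.natAbs_neg]; simp

lemma sum_others (n k : ℕ) [NeZero n] (u : Node n k) (f : ℕ → ℝ) :
    ∑ v ∈ others n k u, f (dM n k u v)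
      = ∑ w ∈ univ.filter (fun w : Node n k => w ≠ 0), f (nrm n k w) := by
  refine Finset.sum_bij' (fun v _ => v - u) (fun w _ => w + u) ?_ ?_ ?_ ?_ ?_
  · intro v hv; simpa [others, sub_eq_zero] using hv
  · intro v hv; simpa [others] using hv
  · intro v hv; simp
  · intro v hv; simp
  · intro v hv; rw [dM_eq]

lemma cnorm_eq (n k : ℕ) [NeZero n] (u : Node n k) (s : ℝ) : cnorm n k u s = C n k s :=
  sum_others n k u (fun d => (d : ℝ) ^ (-s))

lemma nrm_pos (n k : ℕ) [NeZero n] (w : Node n k) (hw : w ≠ 0) : 1 ≤ nrm n k w := by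
  obtain ⟨i, hi⟩ := Function.ne_iff.mp hw
  have h1 : (w i).val ≠ 0 := fun h => hi (Fin.ext (by simpa using h))
  have h2 := (w i).isLt
  have : min (w i).val (n - (w i).val) ≤ nrm n k w :=
    Finset.single_le_sum (f := fun i => min (w i).val (n - (w i).val))
      (fun _ _ => Nat.zero_le _) (mem_univ i)
  omega

lemma nrm_le (n k : ℕ) (w : Node n k) : nrm n k w ≤ k * n := by
  unfold nrm
  calc _ ≤ ∑ i : Fin k, n := Finset.sum_le_sum fun i _ => by omega
    _ = k * n := by simp

lemma card_ne (n k : ℕ) [NeZero n] :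
    ((univ.filter (fun w : Node n k => w ≠ 0)).card : ℝ) = (n : ℝ) ^ k - 1 := by
  rw [Finset.filter_ne', Finset.card_erase_of_mem (mem_univ _)]
  have : 1 ≤ n ^ k := Nat.one_le_pow _ _ (Nat.pos_of_neZero n)
  simp [Nat.cast_sub this]

lemma dM_pos (n k : ℕ) (u v : Node n k) (h : v ∈ others n k u) : 1 ≤ dM n k u v := by
  have hk : k ≠ 0 := by
    rintro rfl; simp [others] at h; exact h.2 (Subsingleton.elim _ _)
  have : NeZero n := ⟨by have := (u ⟨0, by omega⟩).isLt; omega⟩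
  rw [dM_eq]
  exact nrm_pos n k _ (by simpa [others, sub_eq_zero] using h)

lemma C_zero (n k : ℕ) [NeZero n] : C n k 0 = (n : ℝ) ^ k - 1 := by
  unfold C
  rw [← card_ne]; simp

lemma pow_le_C (n k : ℕ) [NeZero n] (s : ℝ) (hs : 0 ≤ s) :
    ((n : ℝ) ^ k - 1) * ((k : ℝ) * n) ^ (-s) ≤ C n k s := by
  rw [← card_ne]
  unfold C
  rw [← nsmul_eq_mul]
  refine Finset.card_nsmul_le_sum _ _ _ fun w hw => ?_
  have h1 := nrm_pos n k w (by simpa using hw)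
  have h2 : (nrm n k w : ℝ) ≤ k * n := by exact_mod_cast nrm_le n k w
  exact Real.rpow_le_rpow_of_nonpos (by exact_mod_cast h1) h2 (by linarith)

lemma C_anti (n k : ℕ) [NeZero n] (s t : ℝ) (h : s ≤ t) : C n k t ≤ C n k s := by
  unfold C
  refine Finset.sum_le_sum fun w hw => ?_
  have h1 := nrm_pos n k w (by simpa using hw)
  exact Real.rpow_le_rpow_of_exponent_le (by exact_mod_cast h1) (by linarith)

/-- The unit offset has norm one. -/
lemma one_le_C (n k : ℕ) [NeZero n] (hn : 2 ≤ n) (hk : 1 ≤ k) (s : ℝ) : 1 ≤ C n k s := by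
  let w : Node n k := Function.update 0 ⟨0, hk⟩ ⟨1, by omega⟩
  have hw : w ≠ 0 := by
    intro h
    have := congrFun h ⟨0, hk⟩
    simp [w, Fin.ext_iff] at this
  have hv : nrm n k w = 1 := by
    unfold nrm
    rw [Finset.sum_eq_single ⟨0, hk⟩]
    · simp [w]; omega
    · intro b _ hb; simp [w, hb]
    · simp
  unfold C
  have : ((nrm n k w : ℕ) : ℝ) ^ (-s) ≤ ∑ w ∈ univ.filter (fun w : Node n k => w ≠ 0), (nrm n k w : ℝ) ^ (-s) :=
    Finset.single_le_sum (f := fun w => (nrm n k w : ℝ) ^ (-s))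
      (fun _ _ => by positivity) (by simpa using hw)
  rw [hv] at this
  simpa using this

lemma linkDist_eq (n k : ℕ) [NeZero n] (u : Node n k) (s : ℝ) :
    linkDist n k u s = C n k (s - 1) / C n k s := by
  rw [← cnorm_eq n k u (s-1), ← cnorm_eq n k u s]
  unfold linkDist linkProb
  conv_rhs => rw [cnorm, Finset.sum_div]
  refine Finset.sum_congr rfl fun v hv => ?_
  have h1 := dM_pos n k u v hv
  have h2 : (0:ℝ) < dM n k u v := by exact_mod_cast h1
  rw [show -(s-1) = -s + 1 by ring, Real.rpow_add_one h2.ne']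
  ring

lemma sum_linkProb (n k : ℕ) [NeZero n] (hn : 2 ≤ n) (hk : 1 ≤ k) (u : Node n k) (s : ℝ) :
    ∑ v ∈ others n k u, linkProb n k u v s = 1 := by
  unfold linkProb
  rw [← Finset.sum_div]
  have : cnorm n k u s ≠ 0 := by
    rw [cnorm_eq]; linarith [one_le_C n k hn hk s]
  exact div_self this

lemma linkProb_nonneg (n k : ℕ) (u v : Node n k) (s : ℝ) : 0 ≤ linkProb n k u v s := by
  unfold linkProb cnorm
  positivity

lemma linkDist_nonneg (n k : ℕ) (u : Node n k) (s : ℝ) : 0 ≤ linkDist n k u s :=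
  Finset.sum_nonneg fun v _ => mul_nonneg (linkProb_nonneg n k u v s) (by positivity)

lemma linkDist_le (n k : ℕ) [NeZero n] (hn : 2 ≤ n) (hk : 1 ≤ k) (u : Node n k) (s : ℝ) :
    linkDist n k u s ≤ k * n := by
  calc linkDist n k u s ≤ ∑ v ∈ others n k u, linkProb n k u v s * (k * n : ℝ) := by
        refine Finset.sum_le_sum fun v _ => mul_le_mul_of_nonneg_left ?_ (linkProb_nonneg n k u v s)
        rw [dM_eq]; exact_mod_cast nrm_le n k _
    _ = k * n := by rw [← Finset.sum_mul, sum_linkProb n k hn hk, one_mul]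

/-- Chebyshev: link distance is maximal at exponent zero. -/
lemma linkDist_le_zero (n k : ℕ) [NeZero n] (hn : 2 ≤ n) (hk : 1 ≤ k) (u : Node n k) (s : ℝ)
    (hs : 0 ≤ s) : linkDist n k u s ≤ linkDist n k u 0 := by
  rw [linkDist_eq, linkDist_eq, div_le_div_iff₀ (by linarith [one_le_C n k hn hk s])
    (by linarith [one_le_C n k hn hk 0]), C_zero, ← card_ne, mul_comm]
  unfold C
  have key : ∀ w ∈ univ.filter (fun w : Node n k => w ≠ 0),
      (nrm n k w : ℝ) ^ (-(s - 1)) = (nrm n k w : ℝ) ^ (-(0 - 1) : ℝ) * (nrm n k w : ℝ) ^ (-s) := by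
    intro w hw
    have h1 := nrm_pos n k w (by simpa using hw)
    rw [← Real.rpow_add (by exact_mod_cast h1)]
    ring_nf
  rw [Finset.sum_congr rfl key]
  apply AntivaryOn.card_mul_sum_le_sum_mul_sum
  intro w hw w' hw' hlt
  have h1 := nrm_pos n k w (by simpa using hw)
  have h1' := nrm_pos n k w' (by simpa using hw')
  simp only [zero_sub, neg_neg, Real.rpow_one]
  by_contra hcon
  push Not at hcon
  have := Real.rpow_le_rpow_of_nonpos (x := (nrm n k w : ℝ)) (y := nrm n k w') (z := -s)
    (by exact_mod_cast h1) hcon.le (by linarith)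
  linarith

/-- Pairing each offset with its antipode. -/
lemma linkDist_zero_ge (n k : ℕ) [NeZero n] (hn : 2 ≤ n) (hk : 1 ≤ k) (u : Node n k) :
    (n : ℝ) / 8 ≤ linkDist n k u 0 := by
  have hN : 1 ≤ C n k 0 := one_le_C n k hn hk 0
  have hC := C_zero n k
  rw [linkDist_eq, le_div_iff₀ (by linarith)]
  let h : Node n k := fun _ => ⟨n / 2, by omega⟩
  have hall : C n k (0 - 1) = ∑ w : Node n k, (nrm n k w : ℝ) := by
    unfold C
    rw [Finset.sum_filter_of_ne]
    · simp
    · intro w _ hw hw0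
      apply hw
      subst hw0
      simp [nrm]
  have hsh : ∑ w : Node n k, (nrm n k (w + h) : ℝ) = ∑ w : Node n k, (nrm n k w : ℝ) :=
    Fintype.sum_equiv (Equiv.addRight h) _ _ (fun w => rfl)
  have hp : ∀ w : Node n k, n / 2 ≤ nrm n k w + nrm n k (w + h) := by
    intro w
    unfold nrm
    rw [← Finset.sum_add_distrib]
    have h1 : ∀ i : Fin k, n / 2 ≤ min (w i).val (n - (w i).val) +
        min ((w + h) i).val (n - ((w + h) i).val) := by
      intro i
      have h3 := (w i).isLt
      have h2 : ((w + h) i).val = if (w i).val + n / 2 < n then (w i).val + n / 2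
          else (w i).val + n / 2 - n := by
        rw [Pi.add_apply, Fin.val_add]
        split_ifs with hh
        · exact Nat.mod_eq_of_lt hh
        · rw [Nat.mod_eq_sub_mod (by simpa [h] using hh)]
          exact Nat.mod_eq_of_lt (by simp only [h]; omega)
      rw [h2]
      split_ifs <;> omega
    exact (h1 ⟨0, hk⟩).trans (Finset.single_le_sum (f := fun i => min (w i).val (n - (w i).val) +
        min ((w + h) i).val (n - ((w + h) i).val)) (fun _ _ => Nat.zero_le _) (mem_univ _))
  have h2 : (n : ℝ) ^ k * (n / 4) ≤ 2 * ∑ w : Node n k, (nrm n k w : ℝ) := by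
    calc (n : ℝ) ^ k * (n / 4) = ∑ w : Node n k, ((n : ℝ) / 4) := by simp
      _ ≤ ∑ w : Node n k, ((nrm n k w : ℝ) + nrm n k (w + h)) := by
          refine Finset.sum_le_sum fun w _ => ?_
          have a1 : n ≤ 4 * (nrm n k w + nrm n k (w + h)) := by have := hp w; omega
          have a2 : (n : ℝ) ≤ 4 * (nrm n k w + nrm n k (w + h)) := by exact_mod_cast a1
          linarith
      _ = 2 * ∑ w : Node n k, (nrm n k w : ℝ) := by
          rw [Finset.sum_add_distrib, hsh]; ring
  rw [hall, hC]
  have : (0:ℝ) ≤ n := by positivity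
  nlinarith

lemma card_line (n j : ℕ) :
    (univ.filter (fun x : Fin n => min x.val (n - x.val) ≤ j)).card ≤ 2 * (j + 1) := by
  have h1 : univ.filter (fun x : Fin n => min x.val (n - x.val) ≤ j) ⊆
      univ.filter (fun x : Fin n => x.val ≤ j) ∪ univ.filter (fun x : Fin n => n - x.val ≤ j) := by
    intro x hx
    simp only [mem_filter, mem_univ, true_and, mem_union] at hx ⊢
    omega
  have h2 : (univ.filter (fun x : Fin n => x.val ≤ j)).card ≤ (range (j + 1)).card := by
    refine Finset.card_le_card_of_injOn (fun x => x.val) ?_ ?_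
    · intro x hx; simp at hx ⊢; omega
    · intro x _ y _ h; exact Fin.ext h
  have h3 : (univ.filter (fun x : Fin n => n - x.val ≤ j)).card ≤ (range (j + 1)).card := by
    refine Finset.card_le_card_of_injOn (fun x => n - x.val) ?_ ?_
    · intro x hx; simp at hx ⊢; omega
    · intro x _ y _ h; exact Fin.ext (by simp only at h; omega)
  have h4 := Finset.card_le_card h1
  have h5 := Finset.card_union_le (univ.filter (fun x : Fin n => x.val ≤ j))
    (univ.filter (fun x : Fin n => n - x.val ≤ j))
  rw [Finset.card_range] at h2 h3
  omega

lemma card_ball (n k j : ℕ) (hj : 1 ≤ j) :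
    (univ.filter (fun w : Node n k => nrm n k w ≤ j)).card ≤ (4 * j) ^ k := by
  have h1 : univ.filter (fun w : Node n k => nrm n k w ≤ j) ⊆
      Fintype.piFinset (fun _ : Fin k =>
        univ.filter (fun x : Fin n => min x.val (n - x.val) ≤ j)) := by
    intro w hw
    simp only [mem_filter, mem_univ, true_and, Fintype.mem_piFinset] at hw ⊢
    intro i
    exact le_trans (Finset.single_le_sum (f := fun i => min (w i).val (n - (w i).val))
      (fun _ _ => Nat.zero_le _) (mem_univ i)) hw
  refine (Finset.card_le_card h1).trans ?_
  rw [Fintype.card_piFinset, Finset.prod_const, Finset.card_univ, Fintype.card_fin]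
  exact Nat.pow_le_pow_left ((card_line n j).trans (by omega)) k

lemma rpow_le_sum (d M : ℕ) (hd : 1 ≤ d) (hM : 2 * d ≤ M) (s : ℝ) (hs : 0 ≤ s) :
    (d : ℝ) ^ (-s) ≤ 2 ^ (s + 1) * ∑ j ∈ Icc 1 M, if d ≤ j then (j : ℝ) ^ (-s - 1) else 0 := by
  have hd' : (0:ℝ) < d := by exact_mod_cast hd
  have h1 : (d : ℝ) * (2 * d : ℝ) ^ (-s - 1) ≤
      ∑ j ∈ Icc 1 M, if d ≤ j then (j : ℝ) ^ (-s - 1) else 0 := by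
    calc (d : ℝ) * (2 * d : ℝ) ^ (-s - 1) = ∑ j ∈ Ioc d (2 * d), (2 * d : ℝ) ^ (-s - 1) := by
          rw [Finset.sum_const, Nat.card_Ioc, nsmul_eq_mul]
          congr 2; omega
      _ ≤ ∑ j ∈ Ioc d (2 * d), if d ≤ j then (j : ℝ) ^ (-s - 1) else 0 := by
          refine Finset.sum_le_sum fun j hj => ?_
          rw [Finset.mem_Ioc] at hj
          rw [if_pos hj.1.le]
          refine Real.rpow_le_rpow_of_nonpos ?_ ?_ (by linarith)
          · exact_mod_cast (by omega : 0 < j)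
          · exact_mod_cast hj.2
      _ ≤ _ := by
          refine Finset.sum_le_sum_of_subset_of_nonneg ?_ ?_
          · intro j hj
            rw [Finset.mem_Ioc] at hj
            rw [Finset.mem_Icc]; omega
          · intro j _ _; split_ifs <;> positivity
  have h2 : (d : ℝ) ^ (-s) = 2 ^ (s + 1) * ((d : ℝ) * (2 * d : ℝ) ^ (-s - 1)) := by
    rw [Real.mul_rpow (by norm_num) hd'.le]
    have e1 : (2:ℝ) ^ (s + 1) * 2 ^ (-s - 1) = 1 := by
      rw [← Real.rpow_add (by norm_num)]; simp
    have e2 : (d : ℝ) * (d : ℝ) ^ (-s - 1) = (d : ℝ) ^ (-s) := by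
      rw [Real.rpow_sub_one hd'.ne']; field_simp
    calc (d : ℝ) ^ (-s) = ((2:ℝ) ^ (s + 1) * 2 ^ (-s - 1)) * ((d : ℝ) * (d : ℝ) ^ (-s - 1)) := by
          rw [e1, e2, one_mul]
      _ = _ := by ring
  rw [h2]
  exact mul_le_mul_of_nonneg_left h1 (by positivity)

lemma C_upper (n k : ℕ) [NeZero n] (s : ℝ) (hs : 0 ≤ s) :
    C n k s ≤ 2 ^ (s + 1) * 4 ^ k * ∑ j ∈ Icc 1 (2 * (k * n)), (j : ℝ) ^ ((k : ℝ) - s - 1) := by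
  calc C n k s ≤ ∑ w ∈ univ.filter (fun w : Node n k => w ≠ 0), 2 ^ (s + 1) *
        ∑ j ∈ Icc 1 (2 * (k * n)), if nrm n k w ≤ j then (j : ℝ) ^ (-s - 1) else 0 := by
        refine Finset.sum_le_sum fun w hw => ?_
        exact rpow_le_sum _ _ (nrm_pos n k w (by simpa using hw))
          (Nat.mul_le_mul_left 2 (nrm_le n k w)) s hs
    _ = 2 ^ (s + 1) * ∑ j ∈ Icc 1 (2 * (k * n)), ∑ w ∈ univ.filter (fun w : Node n k => w ≠ 0),
          if nrm n k w ≤ j then (j : ℝ) ^ (-s - 1) else 0 := by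
        rw [← Finset.mul_sum, Finset.sum_comm]
    _ ≤ 2 ^ (s + 1) * ∑ j ∈ Icc 1 (2 * (k * n)), 4 ^ k * (j : ℝ) ^ ((k : ℝ) - s - 1) := by
        refine mul_le_mul_of_nonneg_left (Finset.sum_le_sum fun j hj => ?_) (by positivity)
        have hj1 := (Finset.mem_Icc.mp hj).1
        have hj0 : (0:ℝ) < j := by exact_mod_cast hj1
        calc _ ≤ ∑ w : Node n k, if nrm n k w ≤ j then (j : ℝ) ^ (-s - 1) else 0 := by
              refine Finset.sum_le_sum_of_subset_of_nonneg (Finset.filter_subset _ _) ?_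
              intro w _ _; split_ifs <;> positivity
          _ = ((univ.filter (fun w : Node n k => nrm n k w ≤ j)).card : ℝ) * (j : ℝ) ^ (-s - 1) := by
              rw [← Finset.sum_filter, Finset.sum_const, nsmul_eq_mul]
          _ ≤ ((4 * j : ℝ) ^ k) * (j : ℝ) ^ (-s - 1) := by
              refine mul_le_mul_of_nonneg_right ?_ (by positivity)
              exact_mod_cast card_ball n k j hj1
          _ = 4 ^ k * (j : ℝ) ^ ((k : ℝ) - s - 1) := by
              rw [mul_pow, mul_assoc, ← Real.rpow_natCast (j:ℝ) k, ← Real.rpow_add hj0]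
              congr 2; ring
    _ = _ := by rw [← Finset.mul_sum]; ring

lemma sum_inv (M : ℕ) : ∑ j ∈ Icc 1 M, (j : ℝ) ^ (-1 : ℝ) ≤ 1 + Real.log M := by
  have := harmonic_le_one_add_log M
  rw [harmonic_eq_sum_Icc] at this
  push_cast at this
  simpa [Real.rpow_neg_one] using this

lemma sum_sq (M : ℕ) : ∑ j ∈ Icc 1 M, (j : ℝ) ^ (-2 : ℝ) ≤ 2 - 2 / (M + 1 : ℝ) := by
  induction M with
  | zero => simp
  | succ m ih =>
    rw [Finset.sum_Icc_succ_top (by omega)]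
    have : ((m + 1 : ℕ) : ℝ) ^ (-2 : ℝ) = 1 / ((m:ℝ) + 1) ^ 2 := by
      rw [Real.rpow_neg (by positivity)]
      norm_cast
      rw [one_div]
    rw [this]
    have h2 : 1 / ((m:ℝ) + 1) ^ 2 ≤ 2 * (1 / ((m:ℝ) + 1) - 1 / ((m:ℝ) + 2)) := by
      rw [div_sub_div _ _ (by positivity) (by positivity), ← mul_div_assoc,
        div_le_div_iff₀ (by positivity) (by positivity)]
      have : (0:ℝ) ≤ m := by positivity
      nlinarith [pow_nonneg this 3]
    push_cast
    have e : (m:ℝ) + 1 + 1 = m + 2 := by ring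
    rw [e]
    have e1 : 2 / ((m:ℝ) + 1) = 2 * (1 / ((m:ℝ) + 1)) := by ring
    have e2 : 2 / ((m:ℝ) + 2) = 2 * (1 / ((m:ℝ) + 2)) := by ring
    rw [e1] at ih
    rw [e2]
    linarith

lemma sum_gamma (γ : ℝ) (h0 : 0 ≤ γ) (h1 : γ < 1) (M : ℕ) :
    ∑ j ∈ Icc 1 M, (j : ℝ) ^ (-γ) ≤ (M : ℝ) ^ (1 - γ) / (1 - γ) := by
  rw [le_div_iff₀ (by linarith)]
  induction M with
  | zero => simp; positivity
  | succ m ih =>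
    rw [Finset.sum_Icc_succ_top (by omega), add_mul]
    have hm : (0:ℝ) < ((m + 1 : ℕ) : ℝ) := by positivity
    have hb := rpow_one_add_le_one_add_mul_self (s := -1 / ((m + 1 : ℕ) : ℝ))
      (by rw [le_div_iff₀ hm]; push_cast; linarith [(by positivity : (0:ℝ) ≤ m)])
      (p := 1 - γ) (by linarith) (by linarith)
    have e1 : (m : ℝ) ^ (1 - γ) = ((m + 1 : ℕ) : ℝ) ^ (1 - γ) *
        (1 + -1 / ((m + 1 : ℕ) : ℝ)) ^ (1 - γ) := by
      have : (1 + -1 / ((m + 1 : ℕ) : ℝ)) = m / ((m + 1 : ℕ) : ℝ) := by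
        field_simp; push_cast; ring
      rw [this, ← Real.mul_rpow hm.le (by positivity)]
      congr 1; field_simp
    have e2 : ((m + 1 : ℕ) : ℝ) ^ (-γ) = ((m + 1 : ℕ) : ℝ) ^ (1 - γ) / ((m + 1 : ℕ) : ℝ) := by
      rw [← Real.rpow_sub_one hm.ne']; congr 1; ring
    have e3 : (m : ℝ) ^ (1 - γ) ≤ ((m + 1 : ℕ) : ℝ) ^ (1 - γ) *
        (1 + (1 - γ) * (-1 / ((m + 1 : ℕ) : ℝ))) := by
      rw [e1]; exact mul_le_mul_of_nonneg_left hb (by positivity)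
    rw [e2]
    calc _ ≤ ((m + 1 : ℕ) : ℝ) ^ (1 - γ) * (1 + (1 - γ) * (-1 / ((m + 1 : ℕ) : ℝ))) +
          ((m + 1 : ℕ) : ℝ) ^ (1 - γ) / ((m + 1 : ℕ) : ℝ) * (1 - γ) := by linarith
      _ = _ := by field_simp; ring

/-- Lower bound of the normalization constant by layers of cubes. -/
lemma C_lower (n k : ℕ) [NeZero n] (hk : 1 ≤ k) :
    ((k : ℝ) ^ k)⁻¹ * Real.log n ≤ C n k k := by
  have hkp : (0:ℝ) < k := by exact_mod_cast hk
  let S : ℕ → Finset (Node n k) := fun m => Fintype.piFinset (fun _ : Fin k =>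
    univ.filter (fun x : Fin n => x.val < m))
  have hcard : ∀ m, m ≤ n → (S m).card = m ^ k := by
    intro m hm
    simp only [S, Fintype.card_piFinset, Finset.prod_const, Finset.card_univ, Fintype.card_fin]
    congr 1
    rw [Fin.card_filter_val_lt]; omega
  have hmono : ∀ m, S m ⊆ S (m + 1) := by
    intro m w hw
    simp only [S, Fintype.mem_piFinset, mem_filter, mem_univ, true_and] at hw ⊢
    intro i; have := hw i; omega
  have hz : ∀ m, 1 ≤ m → (0 : Node n k) ∈ S m := by
    intro m hm
    simp only [S, Fintype.mem_piFinset, mem_filter, mem_univ, true_and]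
    intro i; simpa using Nat.lt_of_succ_le hm
  have key : ∀ m, m + 1 ≤ n → ((k : ℝ) ^ k)⁻¹ * (harmonic m : ℝ) ≤
      ∑ w ∈ (S (m + 1)).erase 0, (nrm n k w : ℝ) ^ (-(k : ℝ)) := by
    intro m
    induction m with
    | zero =>
      intro _; simp only [harmonic_zero, Rat.cast_zero, mul_zero]
      exact Finset.sum_nonneg fun w _ => by positivity
    | succ m ih =>
      intro hm
      have hsub : (S (m + 1)).erase 0 ⊆ (S (m + 1 + 1)).erase 0 :=
        Finset.erase_subset_erase _ (hmono _)
      rw [← Finset.sum_sdiff hsub, harmonic_succ]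
      have h1 := ih (by omega)
      have hc : (m + 1) ^ (k - 1) ≤ ((S (m + 1 + 1)).erase 0 \ (S (m + 1)).erase 0).card := by
        rw [Finset.card_sdiff_of_subset hsub, Finset.card_erase_of_mem (hz _ (by omega)),
          Finset.card_erase_of_mem (hz _ (by omega)), hcard _ hm, hcard _ (by omega)]
        obtain ⟨l, rfl⟩ : ∃ l, k = l + 1 := ⟨k - 1, by omega⟩
        have a1 : (m + 1) ^ l ≤ (m + 1 + 1) ^ l := Nat.pow_le_pow_left (by omega) _
        have a2 : 1 ≤ (m + 1) ^ (l + 1) := Nat.one_le_pow _ _ (by omega)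
        have a3 : (m + 1 + 1) ^ (l + 1) = (m + 1 + 1) ^ l * (m + 1) + (m + 1 + 1) ^ l := by ring
        have a4 : (m + 1) ^ (l + 1) = (m + 1) ^ l * (m + 1) := by ring
        have a5 : (m + 1) ^ l * (m + 1) ≤ (m + 1 + 1) ^ l * (m + 1) := Nat.mul_le_mul_right _ a1
        simp only [Nat.add_sub_cancel]
        omega
      have h2 : ((k : ℝ) ^ k)⁻¹ * ((m + 1 : ℕ) : ℝ)⁻¹ ≤
          ∑ w ∈ (S (m + 1 + 1)).erase 0 \ (S (m + 1)).erase 0, (nrm n k w : ℝ) ^ (-(k : ℝ)) := by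
        have hmp : (0:ℝ) < ((m + 1 : ℕ) : ℝ) := by positivity
        calc ((k : ℝ) ^ k)⁻¹ * ((m + 1 : ℕ) : ℝ)⁻¹
            = ((m + 1 : ℕ) : ℝ) ^ (k - 1) * ((k : ℝ) * ((m + 1 : ℕ) : ℝ)) ^ (-(k : ℝ)) := by
              rw [Real.rpow_neg (by positivity), Real.rpow_natCast, mul_pow]
              obtain ⟨l, rfl⟩ : ∃ l, k = l + 1 := ⟨k - 1, by omega⟩
              simp only [Nat.add_sub_cancel]
              rw [pow_succ ((m + 1 : ℕ) : ℝ) l]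
              field_simp
          _ ≤ (((S (m + 1 + 1)).erase 0 \ (S (m + 1)).erase 0).card : ℝ) *
              ((k : ℝ) * ((m + 1 : ℕ) : ℝ)) ^ (-(k : ℝ)) := by
              refine mul_le_mul_of_nonneg_right ?_ (by positivity)
              exact_mod_cast hc
          _ ≤ _ := by
              rw [← nsmul_eq_mul]
              refine Finset.card_nsmul_le_sum _ _ _ fun w hw => ?_
              have hw1 := Finset.mem_erase.mp (Finset.mem_sdiff.mp hw).1
              have hp := nrm_pos n k w hw1.1
              have hle : nrm n k w ≤ k * (m + 1) := by
                calc nrm n k w ≤ ∑ i : Fin k, (m + 1) := by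
                      refine Finset.sum_le_sum fun i _ => ?_
                      have := hw1.2
                      simp only [S, Fintype.mem_piFinset, mem_filter, mem_univ, true_and] at this
                      have := this i
                      omega
                  _ = k * (m + 1) := by simp
              exact Real.rpow_le_rpow_of_nonpos (by exact_mod_cast hp)
                (by exact_mod_cast hle) (by linarith)
      push_cast at h1 h2 ⊢
      rw [mul_add]
      linarith
  have hn : 0 < n := Nat.pos_of_neZero n
  have h1 := key (n - 1) (by omega)
  have h2 := log_add_one_le_harmonic (n - 1)
  rw [Nat.sub_add_cancel hn] at h1 h2
  calc ((k : ℝ) ^ k)⁻¹ * Real.log n ≤ ((k : ℝ) ^ k)⁻¹ * (harmonic (n - 1) : ℝ) :=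
        mul_le_mul_of_nonneg_left h2 (by positivity)
    _ ≤ _ := h1
    _ ≤ C n k k := by
        unfold C
        refine Finset.sum_le_sum_of_subset_of_nonneg ?_ fun _ _ _ => by positivity
        intro w hw
        simpa using (Finset.mem_erase.mp hw).1

lemma log_ge_one (n : ℕ) (hn : 3 ≤ n) : 1 ≤ Real.log n := by
  rw [Real.le_log_iff_exp_le (by positivity)]
  have : (3:ℝ) ≤ n := by exact_mod_cast hn
  linarith [Real.exp_one_lt_three]

lemma log_sq_le (γ : ℝ) (hγ : 0 < γ) (n : ℕ) (hn : 3 ≤ n) :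
    (Real.log n) ^ 2 ≤ (2 / γ) ^ 2 * (n : ℝ) ^ γ := by
  have h0 := log_ge_one n hn
  have h1 := Real.log_le_rpow_div (x := (n:ℝ)) (by positivity) (ε := γ / 2) (by positivity)
  calc (Real.log n) ^ 2 ≤ ((n : ℝ) ^ (γ / 2) / (γ / 2)) ^ 2 := by gcongr
    _ = (2 / γ) ^ 2 * ((n : ℝ) ^ (γ / 2)) ^ 2 := by field_simp
    _ = (2 / γ) ^ 2 * (n : ℝ) ^ γ := by
        rw [← Real.rpow_natCast ((n : ℝ) ^ (γ / 2)), ← Real.rpow_mul (by positivity)]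
        congr 2; push_cast; ring

lemma C_k_upper (k : ℕ) (hk : 1 ≤ k) : ∃ a : ℝ, 0 < a ∧ ∀ (n : ℕ) [NeZero n], 3 ≤ n →
    C n k k ≤ a * Real.log n := by
  have hk' : (1:ℝ) ≤ k := by exact_mod_cast hk
  have hl : 0 ≤ Real.log (2 * k) := Real.log_nonneg (by linarith)
  refine ⟨2 ^ ((k:ℝ) + 1) * 4 ^ k * (2 + Real.log (2 * k)), by positivity, ?_⟩
  intro n _ hn
  have h0 := log_ge_one n hn
  have hn' : (0:ℝ) < n := by exact_mod_cast (by omega : 0 < n)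
  refine (C_upper n k k (by positivity)).trans ?_
  rw [mul_assoc _ _ (Real.log n)]
  refine mul_le_mul_of_nonneg_left ?_ (by positivity)
  rw [show (k:ℝ) - k - 1 = -1 by ring]
  refine (sum_inv _).trans ?_
  push_cast
  rw [← mul_assoc, Real.log_mul (by positivity) hn'.ne']
  nlinarith

lemma C_km1_upper (k : ℕ) (hk : 1 ≤ k) : ∃ a : ℝ, 0 < a ∧ ∀ (n : ℕ) [NeZero n],
    C n k ((k : ℝ) - 1) ≤ a * n := by
  have hk' : (1:ℝ) ≤ k := by exact_mod_cast hk
  refine ⟨2 ^ ((k:ℝ) - 1 + 1) * 4 ^ k * (2 * k), by positivity, ?_⟩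
  intro n _
  refine (C_upper n k _ (by linarith)).trans (le_of_eq ?_)
  rw [show (k:ℝ) - (k - 1) - 1 = 0 by ring]
  simp
  ring

lemma half_le (n k : ℕ) (hn : 3 ≤ n) (hk : 1 ≤ k) : (n : ℝ) ^ k / 2 ≤ (n : ℝ) ^ k - 1 := by
  have : 3 ≤ n ^ k := hn.trans (Nat.le_self_pow (by omega) n)
  have : (3:ℝ) ≤ (n:ℝ) ^ k := by exact_mod_cast this
  linarith

lemma C_gen_lower (n k : ℕ) [NeZero n] (hn : 3 ≤ n) (hk : 1 ≤ k) (s : ℝ) (hs : 0 ≤ s) :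
    (k : ℝ) ^ (-s) / 2 * (n : ℝ) ^ ((k : ℝ) - s) ≤ C n k s := by
  refine le_trans ?_ (pow_le_C n k s hs)
  have hn' : (0:ℝ) < n := by exact_mod_cast (by omega : 0 < n)
  calc _ = (n : ℝ) ^ k / 2 * ((k : ℝ) * n) ^ (-s) := by
        rw [Real.mul_rpow (by positivity) hn'.le, sub_eq_add_neg, Real.rpow_add hn',
          Real.rpow_natCast]
        ring
    _ ≤ _ := mul_le_mul_of_nonneg_right (half_le n k hn hk) (by positivity)

lemma C_twok_upper (k : ℕ) (hk : 1 ≤ k) : ∃ a : ℝ, 0 < a ∧ ∀ (n : ℕ) [NeZero n],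
    C n k (2 * k : ℝ) ≤ a := by
  have hk' : (1:ℝ) ≤ k := by exact_mod_cast hk
  refine ⟨2 ^ (2 * (k:ℝ) + 1) * 4 ^ k * 2, by positivity, ?_⟩
  intro n _
  refine (C_upper n k _ (by linarith)).trans ?_
  refine mul_le_mul_of_nonneg_left ?_ (by positivity)
  have h := sum_sq (2 * (k * n))
  have h2 : (0:ℝ) ≤ 2 / (((2 * (k * n) : ℕ) : ℝ) + 1) := by positivity
  refine le_trans (Finset.sum_le_sum fun j hj => ?_) (h.trans (by linarith))
  have hj1 : (1:ℝ) ≤ j := by exact_mod_cast (Finset.mem_Icc.mp hj).1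
  exact Real.rpow_le_rpow_of_exponent_le hj1 (by linarith)

lemma C_gamma_upper (k : ℕ) (hk : 1 ≤ k) (γ : ℝ) (h0 : 0 < γ) (h1 : γ < 1) :
    ∃ a : ℝ, 0 < a ∧ ∀ (n : ℕ) [NeZero n], 3 ≤ n →
    C n k ((k : ℝ) + γ - 1) ≤ a * (n / (Real.log n) ^ 2) := by
  have hk' : (1:ℝ) ≤ k := by exact_mod_cast hk
  have h1' : 0 < 1 - γ := by linarith
  refine ⟨2 ^ ((k:ℝ) + γ - 1 + 1) * 4 ^ k * ((2 * k) ^ (1 - γ) / (1 - γ)) * (2 / γ) ^ 2,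
    by positivity, ?_⟩
  intro n _ hn
  have hn' : (0:ℝ) < n := by exact_mod_cast (by omega : 0 < n)
  have hl := log_ge_one n hn
  have hL : (n : ℝ) ^ (1 - γ) ≤ (2 / γ) ^ 2 * (n / (Real.log n) ^ 2) := by
    rw [← mul_div_assoc, le_div_iff₀ (by positivity)]
    calc (n : ℝ) ^ (1 - γ) * (Real.log n) ^ 2
        ≤ (n : ℝ) ^ (1 - γ) * ((2 / γ) ^ 2 * (n : ℝ) ^ γ) :=
          mul_le_mul_of_nonneg_left (log_sq_le γ h0 n hn) (by positivity)
      _ = (2 / γ) ^ 2 * ((n : ℝ) ^ (1 - γ) * (n : ℝ) ^ γ) := by ring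
      _ = (2 / γ) ^ 2 * n := by rw [← Real.rpow_add hn']; simp
  refine (C_upper n k _ (by linarith)).trans ?_
  rw [show (k:ℝ) - (k + γ - 1) - 1 = -γ by ring]
  calc _ ≤ 2 ^ ((k:ℝ) + γ - 1 + 1) * 4 ^ k *
        (((2 * (k * n) : ℕ) : ℝ) ^ (1 - γ) / (1 - γ)) :=
        mul_le_mul_of_nonneg_left (sum_gamma γ h0.le h1 _) (by positivity)
    _ = 2 ^ ((k:ℝ) + γ - 1 + 1) * 4 ^ k * ((2 * k) ^ (1 - γ) / (1 - γ)) * (n : ℝ) ^ (1 - γ) := by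
        push_cast
        rw [← mul_assoc (2:ℝ) (k:ℝ) (n:ℝ), Real.mul_rpow (by positivity) hn'.le]
        ring
    _ ≤ 2 ^ ((k:ℝ) + γ - 1 + 1) * 4 ^ k * ((2 * k) ^ (1 - γ) / (1 - γ)) *
        ((2 / γ) ^ 2 * (n / (Real.log n) ^ 2)) :=
        mul_le_mul_of_nonneg_left hL (by positivity)
    _ = _ := by ring

/-- Key uniform estimate on the ratio of link distance to normalization. -/
lemma ratio_upper (k g : ℕ) (hk : 1 ≤ k) (hg : 2 ≤ g) :
    ∃ a : ℝ, 0 < a ∧ ∀ (n : ℕ) [NeZero n], 3 ≤ n → ∀ (u : Node n k) (s : ℝ),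
    InSigma (g : ℝ)⁻¹ s → linkDist n k u s / C n k s ≤ a * (n / (Real.log n) ^ 2) := by
  have hk' : (1:ℝ) ≤ k := by exact_mod_cast hk
  have hg' : (2:ℝ) ≤ g := by exact_mod_cast hg
  have hgp : (0:ℝ) < g := by linarith
  set γ : ℝ := (g : ℝ)⁻¹ with hγ
  have hγ0 : 0 < γ := by positivity
  have hγ1 : γ < 1 := by
    rw [hγ]; exact inv_lt_one_of_one_lt₀ (by linarith)
  have hgγ : (g:ℝ) * γ = 1 := by rw [hγ]; field_simp
  obtain ⟨a1, ha1, H1⟩ := C_km1_upper k hk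
  obtain ⟨a2, ha2, H2⟩ := C_gamma_upper k hk γ hγ0 hγ1
  have hb : (0:ℝ) < ((k : ℝ) ^ k)⁻¹ := by positivity
  set b := ((k : ℝ) ^ k)⁻¹ with hbdef
  set e : ℝ := (k : ℝ) ^ (-((k : ℝ) - γ)) / 2 with he
  have hep : 0 < e := by positivity
  refine ⟨a1 / b ^ 2 + a2 + k * (2 / γ) ^ 2 / e, by positivity, ?_⟩
  intro n _ hn u s hs
  obtain ⟨m, rfl⟩ := hs
  have hn' : (0:ℝ) < n := by exact_mod_cast (by omega : 0 < n)
  have hl := log_ge_one n hn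
  have hl0 : 0 < Real.log n := by linarith
  have hX : 0 < (n : ℝ) / (Real.log n) ^ 2 := by positivity
  set X := (n : ℝ) / (Real.log n) ^ 2 with hXd
  have p1 : 0 < a1 / b ^ 2 * X := by positivity
  have p2 : 0 < a2 * X := by positivity
  have p3 : 0 < k * (2 / γ) ^ 2 / e * X := by positivity
  have hC1 := one_le_C n k (by omega) hk ((m:ℝ) * γ)
  have hexp : (a1 / b ^ 2 + a2 + k * (2 / γ) ^ 2 / e) * X =
    a1 / b ^ 2 * X + a2 * X + k * (2 / γ) ^ 2 / e * X := by ring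
  rcases lt_trichotomy m (k * g) with h | h | h
  · have h' : (m:ℝ) + 1 ≤ k * g := by exact_mod_cast h
    have hs1 : (m:ℝ) * γ ≤ k - γ := by
      have : ((m:ℝ) + 1) * γ ≤ k * g * γ := mul_le_mul_of_nonneg_right h' hγ0.le
      rw [mul_assoc, hgγ] at this; linarith
    have h1 := C_anti n k _ _ hs1
    have h2 := C_gen_lower n k hn hk ((k:ℝ) - γ) (by linarith)
    rw [show (k:ℝ) - (k - γ) = γ by ring, ← he] at h2
    have h3 : e * (n:ℝ) ^ γ ≤ C n k (m * γ) := h2.trans h1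
    have h4 := log_sq_le γ hγ0 n hn
    have h5 := linkDist_le n k (by omega) hk u ((m:ℝ) * γ)
    have h6 : linkDist n k u (m * γ) / C n k (m * γ) ≤ k * (2 / γ) ^ 2 / e * X := by
      calc _ ≤ (k * n : ℝ) / (e * (n:ℝ) ^ γ) := by gcongr
        _ ≤ (k * n : ℝ) / (e * ((Real.log n) ^ 2 / (2 / γ) ^ 2)) := by
            gcongr
            rw [div_le_iff₀ (by positivity)]; linarith
        _ = _ := by rw [hXd]; field_simp
    linarith
  · have hs1 : (m:ℝ) * γ = k := by
      rw [h]; push_cast; rw [mul_assoc, hgγ, mul_one]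
    have h1 := C_lower n k hk
    rw [linkDist_eq, hs1, div_div]
    have h3 := H1 n
    have h8 : 0 ≤ C n k k := by linarith [one_le_C n k (by omega) hk (k:ℝ)]
    have h6 : C n k (k - 1) / (C n k k * C n k k) ≤ a1 / b ^ 2 * X := by
      calc _ ≤ (a1 * n) / ((b * Real.log n) * (b * Real.log n)) := by gcongr
        _ = _ := by rw [hXd]; field_simp
    linarith
  · have h' : (k:ℝ) * g + 1 ≤ m := by exact_mod_cast h
    have hs1 : (k:ℝ) + γ ≤ (m:ℝ) * γ := by
      have : ((k:ℝ) * g + 1) * γ ≤ m * γ := mul_le_mul_of_nonneg_right h' hγ0.le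
      rw [add_mul, mul_assoc, hgγ] at this; linarith
    have h1 := C_anti n k ((k:ℝ) + γ - 1) ((m:ℝ) * γ - 1) (by linarith)
    have h2 := H2 n hn
    rw [linkDist_eq, div_div]
    have h0 : 0 ≤ C n k ((m:ℝ) * γ - 1) := by
      linarith [one_le_C n k (by omega) hk ((m:ℝ) * γ - 1)]
    have h6 : C n k (m * γ - 1) / (C n k (m * γ) * C n k (m * γ)) ≤ C n k (m * γ - 1) :=
      div_le_self h0 (by nlinarith)
    linarith

lemma mem_others_comm (n k : ℕ) (u v : Node n k) : v ∈ others n k u ↔ u ∈ others n k v := by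
  simp [others, ne_comm]

lemma sum_swap (n k : ℕ) (f : Node n k → Node n k → ℝ) :
    ∑ u, ∑ v ∈ others n k u, f v u = ∑ v, ∑ u ∈ others n k v, f v u := by
  refine Finset.sum_comm' fun u v => ?_
  simp [others, ne_comm]

lemma sum_in_prob (n k : ℕ) [NeZero n] (hn : 2 ≤ n) (hk : 1 ≤ k) (r : Node n k → ℝ) :
    ∑ u, ∑ v ∈ others n k u, linkProb n k v u (r v) = (n : ℝ) ^ k := by
  rw [sum_swap n k (fun v u => linkProb n k v u (r v))]
  rw [Finset.sum_congr rfl fun v _ => sum_linkProb n k hn hk v (r v)]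
  simp

lemma SW_upper (k g : ℕ) (hk : 1 ≤ k) (hg : 2 ≤ g) :
    ∃ a : ℝ, 0 < a ∧ ∀ (n : ℕ) [NeZero n], 3 ≤ n → ∀ r : Node n k → ℝ,
    ValidProfile n k (g : ℝ)⁻¹ r →
      ∑ u, payoff n k r u ≤ a * (n / (Real.log n) ^ 2) * (n : ℝ) ^ k := by
  obtain ⟨a, ha, H⟩ := ratio_upper k g hk hg
  refine ⟨a, ha, ?_⟩
  intro n _ hn r hr
  rw [← sum_in_prob n k (by omega) hk r, Finset.mul_sum]
  refine Finset.sum_le_sum fun u _ => ?_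
  have hr0 : 0 ≤ r u := by
    obtain ⟨m, hm⟩ := hr u
    rw [hm]; positivity
  have hC := one_le_C n k (by omega) hk (r u)
  have hD := linkDist_nonneg n k u (r u)
  unfold payoff recip
  calc _ ≤ linkDist n k u (r u) * ∑ v ∈ others n k u, (1 / C n k (r u)) * linkProb n k v u (r v) := by
        refine mul_le_mul_of_nonneg_left (Finset.sum_le_sum fun v hv => ?_) hD
        refine mul_le_mul_of_nonneg_right ?_ (linkProb_nonneg _ _ _ _ _)
        unfold linkProb
        rw [cnorm_eq]
        have h1 : (1:ℝ) ≤ dM n k u v := by exact_mod_cast dM_pos n k u v hv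
        have h2 := Real.rpow_le_one_of_one_le_of_nonpos h1 (by linarith : -(r u) ≤ 0)
        gcongr
    _ = linkDist n k u (r u) / C n k (r u) * ∑ v ∈ others n k u, linkProb n k v u (r v) := by
        rw [← Finset.mul_sum]; ring
    _ ≤ _ := mul_le_mul_of_nonneg_right (H n hn u (r u) (hr u))
        (Finset.sum_nonneg fun v _ => linkProb_nonneg _ _ _ _ _)

lemma payoff_update (n k : ℕ) (r : Node n k → ℝ) (u : Node n k) (s : ℝ) :
    payoff n k (Function.update r u s) u =
      linkDist n k u s * ∑ v ∈ others n k u, linkProb n k u v s * linkProb n k v u (r v) := by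
  unfold payoff recip
  rw [Function.update_self]
  congr 1
  refine Finset.sum_congr rfl fun v hv => ?_
  rw [Function.update_of_ne (by simpa [others] using hv)]

lemma linkProb_zero (n k : ℕ) [NeZero n] (u v : Node n k) :
    linkProb n k u v 0 = 1 / C n k 0 := by
  unfold linkProb
  rw [cnorm_eq]; simp

lemma nash_lower (n k : ℕ) [NeZero n] (hn : 3 ≤ n) (hk : 1 ≤ k) (γ : ℝ) (r : Node n k → ℝ)
    (hr : IsNash n k γ r) : (n : ℝ) / 8 ≤ ∑ u, payoff n k r u := by
  have hC := one_le_C n k (by omega) hk 0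
  have hCz := C_zero n k
  calc (n : ℝ) / 8 ≤ (n : ℝ) / 8 * (1 / C n k 0) * (n : ℝ) ^ k := by
        rw [mul_assoc]
        refine le_mul_of_one_le_right (by positivity) ?_
        rw [one_div_mul_eq_div, one_le_div (by linarith)]; linarith
    _ = ∑ u, (n : ℝ) / 8 * (1 / C n k 0) * ∑ v ∈ others n k u, linkProb n k v u (r v) := by
        rw [← Finset.mul_sum, sum_in_prob n k (by omega) hk r]
    _ ≤ ∑ u, payoff n k r u := by
        refine Finset.sum_le_sum fun u _ => ?_
        refine le_trans ?_ (hr u 0 ⟨0, by simp⟩)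
        rw [payoff_update, mul_assoc, Finset.mul_sum]
        simp only [linkProb_zero n k u]
        refine mul_le_mul_of_nonneg_right (linkDist_zero_ge n k (by omega) hk u) ?_
        refine Finset.sum_nonneg fun v _ => mul_nonneg (by positivity) (linkProb_nonneg _ _ _ _ _)

lemma zero_payoff (n k : ℕ) [NeZero n] (hn : 3 ≤ n) (hk : 1 ≤ k) (u : Node n k) (s : ℝ) :
    payoff n k (Function.update (fun _ => 0) u s) u = linkDist n k u s / C n k 0 := by
  rw [payoff_update]
  simp only [linkProb_zero]
  rw [← Finset.sum_mul, sum_linkProb n k (by omega) hk]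
  ring

lemma zero_payoff' (n k : ℕ) [NeZero n] (hn : 3 ≤ n) (hk : 1 ≤ k) (u : Node n k) :
    payoff n k (fun _ => 0) u = linkDist n k u 0 / C n k 0 := by
  rw [← zero_payoff n k hn hk u 0]
  congr 1
  exact (Function.update_eq_self u (fun _ => (0:ℝ))).symm

lemma zero_nash (n k : ℕ) [NeZero n] (hn : 3 ≤ n) (hk : 1 ≤ k) (γ : ℝ) (hγ : 0 ≤ γ) :
    IsNash n k γ (fun _ => 0) := by
  intro u s hs
  obtain ⟨m, rfl⟩ := hs
  have hC := one_le_C n k (by omega) hk 0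
  rw [zero_payoff n k hn hk, zero_payoff' n k hn hk]
  have := linkDist_le_zero n k (by omega) hk u ((m:ℝ) * γ) (by positivity)
  gcongr

lemma zero_SW (n k : ℕ) [NeZero n] (hn : 3 ≤ n) (hk : 1 ≤ k) :
    ∑ u, payoff n k (fun _ => 0) u ≤ 2 * k * n := by
  have hC := one_le_C n k (by omega) hk 0
  have hCz := C_zero n k
  have hh := half_le n k hn hk
  calc _ ≤ ∑ u : Node n k, (k * n : ℝ) / C n k 0 := by
        refine Finset.sum_le_sum fun u _ => ?_
        rw [zero_payoff' n k hn hk]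
        have := linkDist_le n k (by omega) hk u 0
        gcongr
    _ = (n : ℝ) ^ k * ((k * n : ℝ) / C n k 0) := by simp
    _ ≤ 2 * k * n := by
        rw [← mul_div_assoc, div_le_iff₀ (by linarith)]
        have : (0:ℝ) ≤ k * n := by positivity
        nlinarith

lemma recip_nonneg (n k : ℕ) (r : Node n k → ℝ) (u : Node n k) : 0 ≤ recip n k r u :=
  Finset.sum_nonneg fun v _ => mul_nonneg (linkProb_nonneg _ _ _ _ _) (linkProb_nonneg _ _ _ _ _)

lemma payoff_nonneg (n k : ℕ) (r : Node n k → ℝ) (u : Node n k) : 0 ≤ payoff n k r u :=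
  mul_nonneg (linkDist_nonneg _ _ _ _) (recip_nonneg _ _ _ _)

/-- Distance between nodes which differ in one coordinate by one. -/
lemma dM_update (n k : ℕ) (hn : 3 ≤ n) (u : Node n k) (i : Fin k) (x : Fin n)
    (hx : x.val = (u i).val + 1 ∨ x.val + 1 = (u i).val) :
    dM n k u (Function.update u i x) = 1 := by
  unfold dM
  rw [Finset.sum_eq_single i]
  · rw [Function.update_self]; omega
  · intro b _ hb
    rw [Function.update_of_ne hb]; simp
  · simp

lemma card_even (n k : ℕ) (hn : 3 ≤ n) (hk : 1 ≤ k) :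
    (n : ℝ) ^ k / 2 ≤ ((univ.filter (fun u : Node n k => (u ⟨0, hk⟩).val % 2 = 0)).card : ℝ) := by
  have h1 : (univ.filter (fun u : Node n k => ¬ (u ⟨0, hk⟩).val % 2 = 0)).card ≤
      (univ.filter (fun u : Node n k => (u ⟨0, hk⟩).val % 2 = 0)).card := by
    refine Finset.card_le_card_of_injOn (fun u => Function.update u ⟨0, hk⟩
      ⟨(u ⟨0, hk⟩).val - 1, by have := (u ⟨0, hk⟩).isLt; omega⟩) ?_ ?_
    · intro u hu
      simp at hu ⊢
      omega
    · intro u hu v hv huv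
      simp at hu hv
      funext i
      have h := congrFun huv i
      by_cases hi : i = ⟨0, hk⟩
      · subst hi
        simp [Fin.ext_iff] at h
        exact Fin.ext (by omega)
      · simpa [Function.update_of_ne hi] using h
  have h2 := Finset.card_filter_add_card_filter_not (s := (univ : Finset (Node n k)))
    (fun u : Node n k => (u ⟨0, hk⟩).val % 2 = 0)
  have h3 : (univ : Finset (Node n k)).card = n ^ k := by simp
  have h4 : n ^ k ≤ 2 * (univ.filter (fun u : Node n k => (u ⟨0, hk⟩).val % 2 = 0)).card := by omega
  have h5 : (n:ℝ) ^ k ≤ 2 * ((univ.filter (fun u : Node n k => (u ⟨0, hk⟩).val % 2 = 0)).card : ℝ) := by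
    exact_mod_cast h4
  linarith

lemma SW_lower (k g : ℕ) (hk : 1 ≤ k) (hg : 2 ≤ g) :
    ∃ a : ℝ, 0 < a ∧ ∀ (n : ℕ) [NeZero n], 3 ≤ n → ∃ r : Node n k → ℝ,
    ValidProfile n k (g : ℝ)⁻¹ r ∧
      a * (n / (Real.log n) ^ 2) * (n : ℝ) ^ k ≤ ∑ u, payoff n k r u := by
  obtain ⟨a2, ha2, H2⟩ := C_k_upper k hk
  obtain ⟨a7, ha7, H7⟩ := C_twok_upper k hk
  have hk' : (1:ℝ) ≤ k := by exact_mod_cast hk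
  have hg' : (2:ℝ) ≤ g := by exact_mod_cast hg
  have ha3 : 0 < (k : ℝ) ^ (-((k:ℝ) - 1)) / 2 := by positivity
  set a3 := (k : ℝ) ^ (-((k:ℝ) - 1)) / 2 with ha3d
  refine ⟨a3 / (a2 ^ 2 * a7) / 2, by positivity, ?_⟩
  intro n _ hn
  have hl := log_ge_one n hn
  have hl0 : 0 < Real.log n := by linarith
  refine ⟨fun u => if (u ⟨0, hk⟩).val % 2 = 0 then (k:ℝ) else 2 * k, ?_, ?_⟩
  · intro u
    dsimp only
    split_ifs
    · exact ⟨k * g, by push_cast; field_simp⟩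
    · exact ⟨2 * k * g, by push_cast; field_simp⟩
  set r : Node n k → ℝ := fun u => if (u ⟨0, hk⟩).val % 2 = 0 then (k:ℝ) else 2 * k with hr
  have hpay : ∀ u ∈ univ.filter (fun u : Node n k => (u ⟨0, hk⟩).val % 2 = 0),
      a3 / (a2 ^ 2 * a7) * (n / (Real.log n) ^ 2) ≤ payoff n k r u := by
    intro u hu
    have hu' : (u ⟨0, hk⟩).val % 2 = 0 := by simpa using hu
    have hru : r u = k := by simp only [hr]; rw [if_pos hu']
    obtain ⟨x, hx⟩ : ∃ x : Fin n, x.val = (u ⟨0, hk⟩).val + 1 ∨ x.val + 1 = (u ⟨0, hk⟩).val := by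
      have := (u ⟨0, hk⟩).isLt
      by_cases h0 : (u ⟨0, hk⟩).val = 0
      · exact ⟨⟨1, by omega⟩, Or.inl (by simp [h0])⟩
      · exact ⟨⟨(u ⟨0, hk⟩).val - 1, by omega⟩, Or.inr (by simp; omega)⟩
    let v : Node n k := Function.update u ⟨0, hk⟩ x
    have hd : dM n k u v = 1 := dM_update n k hn u _ x hx
    have hd' : dM n k v u = 1 := by rw [dM_comm, hd]
    have hv0 : v ⟨0, hk⟩ = x := by simp [v]
    have hvne : v ∈ others n k u := by
      simp only [others, mem_filter, mem_univ, true_and]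
      intro h
      have := congrFun h ⟨0, hk⟩
      rw [hv0] at this
      rw [this] at hx
      omega
    have hrv : r v = 2 * k := by
      simp only [hr]; rw [hv0, if_neg (by omega)]
    have hCk := one_le_C n k (by omega) hk (k:ℝ)
    have hC2 := one_le_C n k (by omega) hk (2 * k:ℝ)
    have hrec : 1 / C n k k * (1 / C n k (2 * k)) ≤ recip n k r u := by
      have : linkProb n k u v (r u) * linkProb n k v u (r v) ≤ recip n k r u :=
        Finset.single_le_sum (f := fun v => linkProb n k u v (r u) * linkProb n k v u (r v))
          (fun v _ => mul_nonneg (linkProb_nonneg _ _ _ _ _) (linkProb_nonneg _ _ _ _ _)) hvne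
      rw [hru, hrv] at this
      unfold linkProb at this
      rw [hd, hd', cnorm_eq, cnorm_eq] at this
      simpa using this
    have hlow := C_gen_lower n k hn hk ((k:ℝ) - 1) (by linarith)
    rw [show (k:ℝ) - (k - 1) = 1 by ring, Real.rpow_one, ← ha3d] at hlow
    have h2 := H2 n hn
    have h7 := H7 n
    have hCm : 0 ≤ C n k ((k:ℝ) - 1) := by
      linarith [one_le_C n k (by omega) hk ((k:ℝ) - 1)]
    have hq : 0 ≤ C n k ((k:ℝ) - 1) / C n k k := div_nonneg hCm (by linarith)
    unfold payoff
    rw [hru, linkDist_eq]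
    calc a3 / (a2 ^ 2 * a7) * (n / (Real.log n) ^ 2)
        = (a3 * n) / (a2 * Real.log n) * (1 / (a2 * Real.log n) * (1 / a7)) := by field_simp
      _ ≤ C n k (k - 1) / C n k k * (1 / C n k k * (1 / C n k (2 * k))) := by gcongr
      _ ≤ _ := by
          refine mul_le_mul_of_nonneg_left hrec ?_
          rw [← linkDist_eq n k u]; exact linkDist_nonneg _ _ _ _
  calc _ = (n : ℝ) ^ k / 2 * (a3 / (a2 ^ 2 * a7) * (n / (Real.log n) ^ 2)) := by ring
    _ ≤ ((univ.filter (fun u : Node n k => (u ⟨0, hk⟩).val % 2 = 0)).card : ℝ) *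
        (a3 / (a2 ^ 2 * a7) * (n / (Real.log n) ^ 2)) :=
        mul_le_mul_of_nonneg_right (card_even n k hn hk) (by positivity)
    _ ≤ ∑ u ∈ univ.filter (fun u : Node n k => (u ⟨0, hk⟩).val % 2 = 0), payoff n k r u := by
        rw [← nsmul_eq_mul]; exact Finset.card_nsmul_le_sum _ _ _ hpay
    _ ≤ _ := Finset.sum_le_sum_of_subset_of_nonneg (Finset.filter_subset _ _)
        fun u _ _ => payoff_nonneg _ _ _ _

end DRBP


/-- The price of anarchy of the DRB game is `Θ(n^k/(ln n)^2)`: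
`PoA = (sup of social welfare over valid profiles) /
(inf of social welfare over Nash equilibria)` satisfies
`c1·n^k/(ln n)^2 ≤ PoA ≤ c2·n^k/(ln n)^2` for all large `n`. -/
theorem price_of_anarchy (k g : ℕ) (hk : 1 ≤ k) (hg : 2 ≤ g) :
    ∃ c1 c2 : ℝ, 0 < c1 ∧ 0 < c2 ∧ ∃ n0 : ℕ, ∀ n : ℕ, n0 ≤ n →
      c1 * (n : ℝ) ^ k / (Real.log n) ^ 2 ≤
        (sSup {x : ℝ | ∃ r : DRB.Node n k → ℝ,
            DRB.ValidProfile n k (g : ℝ)⁻¹ r ∧ x = ∑ u, DRB.payoff n k r u}) /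
        (sInf {x : ℝ | ∃ r : DRB.Node n k → ℝ,
            DRB.ValidProfile n k (g : ℝ)⁻¹ r ∧ DRB.IsNash n k (g : ℝ)⁻¹ r ∧
            x = ∑ u, DRB.payoff n k r u}) ∧
      (sSup {x : ℝ | ∃ r : DRB.Node n k → ℝ,
          DRB.ValidProfile n k (g : ℝ)⁻¹ r ∧ x = ∑ u, DRB.payoff n k r u}) /
        (sInf {x : ℝ | ∃ r : DRB.Node n k → ℝ,
            DRB.ValidProfile n k (g : ℝ)⁻¹ r ∧ DRB.IsNash n k (g : ℝ)⁻¹ r ∧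
            x = ∑ u, DRB.payoff n k r u}) ≤ c2 * (n : ℝ) ^ k / (Real.log n) ^ 2 := by
  obtain ⟨A, hA, HA⟩ := DRBP.SW_upper k g hk hg
  obtain ⟨B, hB, HB⟩ := DRBP.SW_lower k g hk hg
  have hk' : (1:ℝ) ≤ k := by exact_mod_cast hk
  refine ⟨B / (2 * k), 8 * A, by positivity, by positivity, 3, ?_⟩
  intro n hn
  have : NeZero n := ⟨by omega⟩
  have hl := DRBP.log_ge_one n hn
  have hn' : (0:ℝ) < n := by exact_mod_cast (by omega : 0 < n)
  set S1 : Set ℝ := {x : ℝ | ∃ r : DRB.Node n k → ℝ,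
    DRB.ValidProfile n k (g : ℝ)⁻¹ r ∧ x = ∑ u, DRB.payoff n k r u} with hS1
  set S2 : Set ℝ := {x : ℝ | ∃ r : DRB.Node n k → ℝ,
    DRB.ValidProfile n k (g : ℝ)⁻¹ r ∧ DRB.IsNash n k (g : ℝ)⁻¹ r ∧
    x = ∑ u, DRB.payoff n k r u} with hS2
  obtain ⟨r, hr, hrB⟩ := HB n hn
  have hup : ∀ x ∈ S1, x ≤ A * (n / (Real.log n) ^ 2) * (n : ℝ) ^ k := by
    rintro x ⟨r, hr, rfl⟩
    exact HA n hn r hr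
  have hsup1 : sSup S1 ≤ A * (n / (Real.log n) ^ 2) * (n : ℝ) ^ k :=
    csSup_le ⟨_, r, hr, rfl⟩ hup
  have hsup2 : B * (n / (Real.log n) ^ 2) * (n : ℝ) ^ k ≤ sSup S1 :=
    hrB.trans (le_csSup ⟨_, hup⟩ ⟨r, hr, rfl⟩)
  have hlow : ∀ x ∈ S2, (n : ℝ) / 8 ≤ x := by
    rintro x ⟨r, _, hr, rfl⟩
    exact DRBP.nash_lower n k hn hk _ r hr
  have hmem : (∑ u, DRB.payoff n k (fun _ => 0) u) ∈ S2 :=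
    ⟨fun _ => 0, fun _ => ⟨0, by simp⟩, DRBP.zero_nash n k hn hk _ (by positivity), rfl⟩
  have hinf1 : (n : ℝ) / 8 ≤ sInf S2 := le_csInf ⟨_, hmem⟩ hlow
  have hinf2 : sInf S2 ≤ 2 * k * n :=
    (csInf_le ⟨_, hlow⟩ hmem).trans (DRBP.zero_SW n k hn hk)
  have hpos : 0 < sInf S2 := lt_of_lt_of_le (by positivity) hinf1
  constructor
  · calc _ = (B * (n / (Real.log n) ^ 2) * (n : ℝ) ^ k) / (2 * k * n) := by field_simp
      _ ≤ sSup S1 / sInf S2 := by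
        have : 0 ≤ sSup S1 := le_trans (by positivity) hsup2
        gcongr
  · calc _ ≤ (A * (n / (Real.log n) ^ 2) * (n : ℝ) ^ k) / (n / 8) := by gcongr
      _ = _ := by field_simp
end
end
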